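/- arXiv:1209.6019 — 5 statements merged into one kernel-verified Lean document; each statement's English description precedes it below -/
import Mathlib

section
/- The set B^{m,i} is finite and its cardinality equals the dimension of the irreducible sl_{n+1}(ℂ)-module V(mω_i) of highest weight mω_i; explicitly, #B^{m,i} = ∏_{a=1}^{i} ∏_{b=i+1}^{n+1} (m + b − a)/(b − a). -/
open Finset

namespace KR

/-- Arrays of integers indexed by (column, row). -/
abbrev Arr := ℕ → ℕ → ℤ

/-- A Dyck path from (1,i) to (i,n). -/
def IsDyck (n i : ℕ) (L : List (ℕ × ℕ)) : Prop :=
  L ≠ [] ∧ L.head? = some (1, i) ∧ L.getLast? = some (i, n) ∧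
    L.Chain' (fun β γ => γ = (β.1, β.2 + 1) ∨ γ = (β.1 + 1, β.2))

/-- Membership in the polytope `B^{m,i}`: nonnegative entries supported on the box
`1 ≤ p ≤ i`, `i ≤ q ≤ n`, with all Dyck path sums bounded by `m`. -/
def InB (n i m : ℕ) (A : Arr) : Prop :=
  (∀ p q, 1 ≤ p → p ≤ i → i ≤ q → q ≤ n → 0 ≤ A p q) ∧
  (∀ p q, ¬(1 ≤ p ∧ p ≤ i ∧ i ≤ q ∧ q ≤ n) → A p q = 0) ∧
  (∀ L, IsDyck n i L → (L.map fun β => A β.1 β.2).sum ≤ (m : ℤ))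

/-- The sum `Σ_{j=1}^{p} a_{j,l−1} + Σ_{j=p}^{i} a_{j,l}` (used for `l > i`). -/
def Fp (i : ℕ) (A : Arr) (l p : ℕ) : ℤ :=
  ∑ j ∈ Icc 1 p, A j (l - 1) + ∑ j ∈ Icc p i, A j l

/-- `p_+^l(A)`: minimal maximizer of `Fp` on `{1,…,i}`. -/
noncomputable def pplus (i : ℕ) (A : Arr) (l : ℕ) : ℕ :=
  sInf {p | p ∈ Icc 1 i ∧ ∀ q ∈ Icc 1 i, Fp i A l q ≤ Fp i A l p}

/-- `q_+^l(A)`: maximal maximizer of `Fp` on `{1,…,i}`. -/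
noncomputable def qplus (i : ℕ) (A : Arr) (l : ℕ) : ℕ :=
  sSup {p | p ∈ Icc 1 i ∧ ∀ q ∈ Icc 1 i, Fp i A l q ≤ Fp i A l p}

/-- The sum `Σ_{j=i}^{p} a_{l,j} + Σ_{j=p}^{n} a_{l+1,j}` (used for `l < i`). -/
def Fm (n i : ℕ) (A : Arr) (l p : ℕ) : ℤ :=
  ∑ j ∈ Icc i p, A l j + ∑ j ∈ Icc p n, A (l + 1) j

/-- `p_−^l(A)`: maximal maximizer of `Fm` on `{i,…,n}`. -/
noncomputable def pminus (n i : ℕ) (A : Arr) (l : ℕ) : ℕ :=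
  sSup {p | p ∈ Icc i n ∧ ∀ q ∈ Icc i n, Fm n i A l q ≤ Fm n i A l p}

/-- `q_−^l(A)`: minimal maximizer of `Fm` on `{i,…,n}`. -/
noncomputable def qminus (n i : ℕ) (A : Arr) (l : ℕ) : ℕ :=
  sInf {p | p ∈ Icc i n ∧ ∀ q ∈ Icc i n, Fm n i A l q ≤ Fm n i A l p}

/-- `φ_l(A)` (depending on the parameter `m` only when `l = i`). -/
noncomputable def phi (n i m : ℕ) (l : ℕ) (A : Arr) : ℤ :=
  if l = i then (m : ℤ) - ∑ j ∈ Icc 1 (i - 1), A j i - ∑ j ∈ Icc i n, A i j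
  else if i < l then
    ∑ j ∈ Icc 1 (pplus i A l), A j (l - 1) - ∑ j ∈ Icc 1 (pplus i A l - 1), A j l
  else
    ∑ j ∈ Icc (pminus n i A l) n, A (l + 1) j - ∑ j ∈ Icc (pminus n i A l + 1) n, A l j

/-- `ε_l(A)` (the parameter `m` is carried along for uniformity; it is not used). -/
noncomputable def eps (n i m : ℕ) (l : ℕ) (A : Arr) : ℤ :=
  if l = i then A i i
  else if i < l then
    ∑ j ∈ Icc (qplus i A l) i, A j l - ∑ j ∈ Icc (qplus i A l + 1) i, A j (l - 1)
  else
    ∑ j ∈ Icc i (qminus n i A l), A l j - ∑ j ∈ Icc i (qminus n i A l - 1), A (l + 1) j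

/-- Update a single entry of an array. -/
def upd (A : Arr) (p q : ℕ) (v : ℤ) : Arr :=
  fun p' q' => if p' = p ∧ q' = q then v else A p' q'

/-- The Kashiwara operator `f_l` (with `none` playing the role of `0`). -/
noncomputable def fop (n i m : ℕ) (l : ℕ) (A : Arr) : Option Arr :=
  if phi n i m l A = 0 then none
  else some <|
    if l = i then upd A i i (A i i + 1)
    else if i < l then
      upd (upd A (pplus i A l) (l - 1) (A (pplus i A l) (l - 1) - 1))
        (pplus i A l) l (A (pplus i A l) l + 1)
    else
      upd (upd A l (pminus n i A l) (A l (pminus n i A l) + 1))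
        (l + 1) (pminus n i A l) (A (l + 1) (pminus n i A l) - 1)

/-- The Kashiwara operator `e_l` (with `none` playing the role of `0`). -/
noncomputable def eop (n i m : ℕ) (l : ℕ) (A : Arr) : Option Arr :=
  if eps n i m l A = 0 then none
  else some <|
    if l = i then upd A i i (A i i - 1)
    else if i < l then
      upd (upd A (qplus i A l) (l - 1) (A (qplus i A l) (l - 1) + 1))
        (qplus i A l) l (A (qplus i A l) l - 1)
    else
      upd (upd A l (qminus n i A l) (A l (qminus n i A l) - 1))
        (l + 1) (qminus n i A l) (A (l + 1) (qminus n i A l) + 1)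

/-- Coefficient of `ω_j` in the simple root `α_r` (column `r` of the Cartan matrix). -/
def cart (j r : ℕ) : ℤ :=
  if r = j then 2 else if r = j + 1 ∨ j = r + 1 then -1 else 0

/-- The weight `wt(A) = mω_i − Σ a_{p,q} α_{p,q}`, expressed in the basis of
fundamental weights: `wtv n i m A j` is the coefficient of `ω_j`. -/
def wtv (n i m : ℕ) (A : Arr) (j : ℕ) : ℤ :=
  (m : ℤ) * (if j = i then 1 else 0) -
    ∑ p ∈ Icc 1 i, ∑ q ∈ Icc i n, A p q * ∑ r ∈ Icc p q, cart j r

/-- The coefficient `c_l(p,q)` of the pairing `⟨α_l^∨, α_{p,q}⟩`. -/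
def clpq (l p q : ℕ) : ℤ :=
  if p = l ∧ q = l then 2
  else if (l = p ∧ p < q) ∨ (p < q ∧ q = l) then 1
  else if l + 1 = p ∨ l = q + 1 then -1
  else 0

/-- The pairing `⟨α_l^∨, wt(A)⟩ = m·δ_{l,i} − Σ_{p,q} a_{p,q}·c_l(p,q)`. -/
def pairing (n i m : ℕ) (l : ℕ) (A : Arr) : ℤ :=
  (m : ℤ) * (if l = i then 1 else 0) -
    ∑ p ∈ Icc 1 i, ∑ q ∈ Icc i n, A p q * clpq l p q

/-! ### The promotion algorithm -/

/-- Columns, indexed by rows `i,…,n`. -/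
abbrev Col := ℕ → ℤ

/-- `Σ_{j=lo}^{p} a_j + Σ_{j=p}^{n} b_j`. -/
def Gc (n lo : ℕ) (a b : Col) (p : ℕ) : ℤ := ∑ j ∈ Icc lo p, a j + ∑ j ∈ Icc p n, b j

/-- `q_−` for two (truncated) columns with rows `lo,…,n`: the minimal maximizer of `Gc`. -/
noncomputable def qmc (n lo : ℕ) (a b : Col) : ℕ :=
  if lo ≤ n then
    max lo (sInf {p | p ∈ Icc lo n ∧ ∀ q ∈ Icc lo n, Gc n lo a b q ≤ Gc n lo a b p})
  else n

/-- `ε` for two (truncated) columns with rows `lo,…,n`. -/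
noncomputable def epsc (n lo : ℕ) (a b : Col) : ℤ :=
  ∑ j ∈ Icc lo (qmc n lo a b), a j - ∑ j ∈ Icc lo (qmc n lo a b - 1), b j

/-- The sequence `l_1 < l_2 < ⋯` of the promotion algorithm:
`l_1 = q_−(a,c)` and `l_{s+1} = q_−((a)^{≥ l_s + 1}, (c)^{≥ l_s + 1})`,
stabilizing at `n`. -/
noncomputable def lfun (n i : ℕ) (a c : Col) : ℕ → ℕ
  | 0 => qmc n i a c
  | s + 1 => qmc n (lfun n i a c s + 1) a c

/-- The set `{l_1, …, l_t}` (with `l_t = n`). -/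
noncomputable def lset (n i : ℕ) (a c : Col) : Finset ℕ := (Finset.range (n + 1)).image (lfun n i a c)

/-- The new column `ĉ` of formula (6.2). -/
noncomputable def hatc (n i : ℕ) (a c : Col) : Col := fun r =>
  if r = n then a n + c n
  else if r ∈ lset n i a c then a r + c r - epsc n (r + 1) a c
  else a r

/-- The output column of one step of the promotion algorithm. -/
noncomputable def prcol (n i : ℕ) (a c : Col) : Col := fun r =>
  if r = i then epsc n i a c
  else if r - 1 ∈ lset n i a c then epsc n r a c
  else c (r - 1)

/-- The running columns of the promotion algorithm: `cseq 0` is the `i`-th column of `A`,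
and `cseq (k+1)` is obtained from the `(i−1−k)`-th column of `A` and `cseq k`. -/
noncomputable def cseq (n i : ℕ) (A : Arr) : ℕ → Col
  | 0 => fun r => A i r
  | k + 1 => hatc n i (fun r => A (i - 1 - k) r) (cseq n i A k)

/-- The `j`-th column of `pr(A)` for `2 ≤ j ≤ i`. -/
noncomputable def prColJ (n i : ℕ) (A : Arr) (j : ℕ) : Col :=
  prcol n i (fun q => A (j - 1) q) (cseq n i A (i - j))

/-- The promotion map `pr` on `B^{m,i}`. -/
noncomputable def prMap (n i m : ℕ) (A : Arr) : Arr := fun p r =>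
  if 1 ≤ p ∧ p ≤ i ∧ i ≤ r ∧ r ≤ n then
    if p = 1 then
      if r = i then
        (m : ℤ) - (∑ j ∈ Icc i n, A i j) - ∑ j ∈ Icc 2 i, prColJ n i A j i
      else
        (∑ j ∈ Icc 1 i, A j (r - 1)) - ∑ j ∈ Icc 2 i, prColJ n i A j r
    else prColJ n i A p r
  else 0

/-- The content `(r_1,…,r_{n+1})` of an array. -/
def cont (n i m : ℕ) (A : Arr) (k : ℕ) : ℤ :=
  if k ≤ i then (m : ℤ) - ∑ q ∈ Icc i n, A k q else ∑ p ∈ Icc 1 i, A p (k - 1)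

open Classical in
/-- Strict Gelfand–Tsetlin patterns with `N` rows and top row `l`. -/
noncomputable def gtPatterns : (N : ℕ) → (Fin N → ℤ) → Finset ((r : ℕ) → Fin r → ℤ)
  | 0, _ => {0}
  | N + 1, l =>
    (Fintype.piFinset fun j : Fin N => Ico (l j.castSucc) (l j.succ)).biUnion fun μ =>
      (gtPatterns N μ).image fun G => Function.update G (N + 1) l

theorem mem_gtPatterns {N : ℕ} {l : Fin N → ℤ} {G : (r : ℕ) → Fin r → ℤ} :
    G ∈ gtPatterns N l ↔ G N = l ∧ (∀ r, N < r → G r = 0) ∧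
      ∀ r < N, ∀ j : Fin r, G (r + 1) j.castSucc ≤ G r j ∧ G r j < G (r + 1) j.succ := by
  induction N generalizing G with
  | zero =>
    simp only [gtPatterns, mem_singleton]
    constructor
    · rintro rfl
      exact ⟨Subsingleton.elim _ _, fun _ _ => rfl, fun r hr => by omega⟩
    · rintro ⟨-, h, -⟩
      funext r
      rcases r with _ | r
      · exact Subsingleton.elim _ _
      · exact h _ (by omega)
  | succ N ih =>
    simp only [gtPatterns, mem_biUnion, mem_image, Fintype.mem_piFinset, mem_Ico]
    constructor
    · rintro ⟨μ, hμ, G, hG, rfl⟩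
      obtain ⟨h1, h2, h3⟩ := ih.1 hG
      refine ⟨by simp, fun r hr => ?_, fun r hr j => ?_⟩
      · rw [Function.update_of_ne (by omega)]
        exact h2 r (by omega)
      · rw [Function.update_of_ne (by omega : r ≠ N + 1)]
        rcases (by omega : r < N ∨ r = N) with hr | rfl
        · rw [Function.update_of_ne (by omega)]
          exact h3 r hr j
        · rw [Function.update_self, h1]
          exact hμ j
    · rintro ⟨h1, h2, h3⟩
      refine ⟨G N, fun j => ?_, Function.update G (N + 1) 0, ih.2 ⟨?_, ?_, ?_⟩, ?_⟩
      · subst h1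
        exact h3 N (by omega) j
      · rw [Function.update_of_ne (by omega)]
      · intro r hr
        by_cases h : r = N + 1
        · subst h; simp
        · rw [Function.update_of_ne h]
          exact h2 r (by omega)
      · intro r hr j
        rw [Function.update_of_ne (by omega), Function.update_of_ne (by omega)]
        exact h3 r (by omega) j
      · subst h1
        simp

open Classical in
theorem card_gtPatterns_succ (N : ℕ) (l : Fin (N + 1) → ℤ) :
    (gtPatterns (N + 1) l).card =
      ∑ μ ∈ Fintype.piFinset fun j : Fin N => Ico (l j.castSucc) (l j.succ),
        (gtPatterns N μ).card := by
  rw [gtPatterns, card_biUnion]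
  · refine sum_congr rfl fun μ _ => card_image_of_injOn ?_
    intro G hG G' hG' h
    obtain ⟨-, h2, -⟩ := mem_gtPatterns.1 hG
    obtain ⟨-, h2', -⟩ := mem_gtPatterns.1 hG'
    funext r
    by_cases hr : r = N + 1
    · subst hr
      rw [h2 _ (by omega), h2' _ (by omega)]
    · simpa [Function.update_of_ne hr] using congrFun h r
  · intro μ _ ν _ hμν
    rw [Function.onFun, disjoint_left]
    simp only [mem_image]
    rintro _ ⟨G, hG, rfl⟩ ⟨G', hG', h⟩
    refine hμν ?_
    rw [← (mem_gtPatterns.1 hG).1, ← (mem_gtPatterns.1 hG').1]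
    simpa [Function.update_of_ne (by omega : N ≠ N + 1)] using (congrFun h N).symm

theorem descPochhammer_eval_add_one (k : ℕ) (x : ℚ) :
    (descPochhammer ℚ (k + 1)).eval (x + 1) - (descPochhammer ℚ (k + 1)).eval x =
      (k + 1) * (descPochhammer ℚ k).eval x := by
  have h := congrArg (Polynomial.eval (x + 1)) (descPochhammer_succ_comp_X_sub_one ℚ k)
  simp at h
  linarith

theorem sum_Ico_descPochhammer (k : ℕ) {a b : ℤ} (hab : a ≤ b) :
    ∑ x ∈ Ico a b, (k + 1) * (descPochhammer ℚ k).eval (x : ℚ) =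
      (descPochhammer ℚ (k + 1)).eval (b : ℚ) - (descPochhammer ℚ (k + 1)).eval (a : ℚ) := by
  induction b, hab using Int.leInduction with
  | base => simp
  | succ b hab ih =>
    rw [← Finset.insert_Ico_right_eq_Ico_add_one hab, sum_insert (by simp), ih,
      ← descPochhammer_eval_add_one]
    push_cast
    ring

/-- The determinant of the falling factorials of the entries of `l`. -/
noncomputable def fallingDet {N : ℕ} (l : Fin N → ℤ) : ℚ :=
  Matrix.det (Matrix.of fun j k : Fin N => (descPochhammer ℚ k).eval (l j : ℚ))

theorem fallingDet_eq_prod {N : ℕ} (l : Fin N → ℤ) :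
    fallingDet l = ∏ a : Fin N, ∏ b ∈ Ioi a, ((l b : ℚ) - l a) := by
  rw [← Matrix.det_vandermonde,
    Matrix.det_eval_matrixOfPolynomials_eq_det_vandermonde (fun j => (l j : ℚ))
      (fun k => descPochhammer ℚ k) (fun k => descPochhammer_natDegree ℚ k)
      (fun k => monic_descPochhammer ℚ k)]
  rfl

theorem fallingDet_succ {N : ℕ} {l : Fin (N + 1) → ℤ} (hl : Monotone l) :
    fallingDet l = (N.factorial : ℚ) *
      ∑ μ ∈ Fintype.piFinset fun j : Fin N => Ico (l j.castSucc) (l j.succ), fallingDet μ := by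
  have hdiff : fallingDet l = Matrix.det (Matrix.of fun j k : Fin N =>
      (descPochhammer ℚ (k + 1)).eval (l j.succ : ℚ) -
        (descPochhammer ℚ (k + 1)).eval (l j.castSucc : ℚ)) := by
    rw [fallingDet, Matrix.det_eq_of_forall_row_eq_smul_add_pred (B := Matrix.of
      (Fin.cons (fun k : Fin (N + 1) => (descPochhammer ℚ k).eval (l 0 : ℚ))
        fun (j : Fin N) (k : Fin (N + 1)) => (descPochhammer ℚ k).eval (l j.succ : ℚ) -
          (descPochhammer ℚ k).eval (l j.castSucc : ℚ))) (fun _ => 1) (by simp) (by simp),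
      Matrix.det_succ_column_zero, Fin.sum_univ_succ]
    simp [Matrix.submatrix]
  have hsum : ∑ μ ∈ Fintype.piFinset fun j : Fin N => Ico (l j.castSucc) (l j.succ),
      fallingDet μ = Matrix.det (Matrix.of fun j k : Fin N =>
        ∑ x ∈ Ico (l j.castSucc) (l j.succ), (descPochhammer ℚ k).eval (x : ℚ)) := by
    have := (Matrix.detRowAlternating (R := ℚ) (n := Fin N)).toMultilinearMap.map_sum_finset
      (fun _ (x : ℤ) (k : Fin N) => (descPochhammer ℚ k).eval (x : ℚ))
      (fun j => Ico (l j.castSucc) (l j.succ))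
    refine this.symm.trans (congrArg Matrix.det ?_)
    ext j k
    simp
  have hfac : (N.factorial : ℚ) = ∏ k : Fin N, ((k : ℕ) + 1 : ℚ) := by
    rw [Fin.prod_univ_eq_prod_range (fun k : ℕ => (k + 1 : ℚ)), ← prod_range_add_one_eq_factorial]
    push_cast
    rfl
  rw [hdiff, hsum, hfac, ← Matrix.det_mul_row]
  congr 1
  ext j k
  simp only [Matrix.of_apply]
  rw [mul_sum, sum_Ico_descPochhammer _ (hl j.castSucc_lt_succ.le)]

theorem card_gtPatterns_mul {N : ℕ} {l : Fin N → ℤ} (hl : Monotone l) :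
    ((gtPatterns N l).card : ℚ) * (∏ k ∈ range N, k.factorial : ℕ) = fallingDet l := by
  induction N with
  | zero => simp [gtPatterns, fallingDet]
  | succ N ih =>
    rw [fallingDet_succ hl, card_gtPatterns_succ, prod_range_succ, mul_sum]
    push_cast
    rw [sum_mul]
    refine sum_congr rfl fun μ hμ => ?_
    simp only [Fintype.mem_piFinset, mem_Ico] at hμ
    rw [← ih]
    · push_cast
      ring
    · intro a b hab
      rcases hab.eq_or_lt with rfl | hab
      · rfl
      · exact (hμ a).2.le.trans ((hl (show a.succ ≤ b.castSucc from hab)).trans (hμ b).1)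

theorem fallingDet_val (N : ℕ) :
    fallingDet (fun j : Fin N => (j : ℤ)) = (∏ k ∈ range N, k.factorial : ℕ) := by
  induction N with
  | zero => simp [fallingDet]
  | succ N ih =>
    rw [fallingDet_succ fun a b h => by simpa using h, prod_range_succ]
    have : (Fintype.piFinset fun j : Fin N =>
        Ico ((j.castSucc : ℕ) : ℤ) ((j.succ : ℕ) : ℤ)) = {fun j : Fin N => (j : ℤ)} := by
      ext μ
      simp only [Fintype.mem_piFinset, mem_Ico, mem_singleton, funext_iff]
      refine forall_congr' fun j => ?_
      simp
      omega
    rw [this, sum_singleton, ih]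
    push_cast
    ring

theorem card_gtPatterns {N : ℕ} {l : Fin N → ℤ} (hl : Monotone l) :
    ((gtPatterns N l).card : ℚ) =
      ∏ a : Fin N, ∏ b ∈ Ioi a, ((l b : ℚ) - l a) / ((b : ℚ) - a) := by
  have h := card_gtPatterns_mul hl
  have h0 : ((∏ k ∈ range N, k.factorial : ℕ) : ℚ) ≠ 0 := by
    exact_mod_cast prod_ne_zero_iff.2 fun k _ => Nat.factorial_ne_zero k
  rw [eq_div_of_mul_eq h0 h, ← fallingDet_val, fallingDet_eq_prod, fallingDet_eq_prod]
  simp_rw [prod_div_distrib]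
  push_cast
  rfl

/-- The shifted rectangular top row. -/
def rectRow (i m N : ℕ) : Fin N → ℤ := fun j => (j : ℤ) + if i ≤ (j : ℕ) then (m : ℤ) else 0

theorem monotone_rectRow (i m N : ℕ) : Monotone (rectRow i m N) := by
  intro a b hab
  have : (a : ℕ) ≤ b := hab
  simp only [rectRow]
  split_ifs <;> omega

theorem card_gtPatterns_rectRow {n i : ℕ} (hin : i ≤ n) (m : ℕ) :
    ((gtPatterns (n + 1) (rectRow i m (n + 1))).card : ℚ) =
      ∏ a ∈ Finset.Icc 1 i, ∏ b ∈ Finset.Icc (i + 1) (n + 1),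
        ((m : ℚ) + (b : ℚ) - (a : ℚ)) / ((b : ℚ) - (a : ℚ)) := by
  rw [card_gtPatterns (monotone_rectRow ..), prod_sigma', prod_sigma']
  symm
  refine prod_of_injOn (fun x => ⟨Fin.ofNat (n + 1) (x.1 - 1), Fin.ofNat (n + 1) (x.2 - 1)⟩)
    ?_ ?_ ?_ ?_
  · rintro ⟨a, b⟩ hx ⟨a', b'⟩ hx' h
    simp only [coe_sigma, Set.mem_sigma_iff, coe_Icc, Set.mem_Icc] at hx hx'
    simp only [Sigma.mk.injEq, Fin.ext_iff, Fin.ofNat, heq_eq_eq] at h ⊢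
    rw [Nat.mod_eq_of_lt (by omega), Nat.mod_eq_of_lt (by omega), Nat.mod_eq_of_lt (by omega),
      Nat.mod_eq_of_lt (by omega)] at h
    omega
  · rintro ⟨a, b⟩ hx
    simp only [coe_sigma, Set.mem_sigma_iff, coe_Icc, Set.mem_Icc] at hx
    simp only [coe_sigma, Set.mem_sigma_iff, coe_univ, Set.mem_univ, coe_Ioi, Set.mem_Ioi,
      true_and, Fin.lt_def, Fin.ofNat]
    rw [Nat.mod_eq_of_lt (by omega), Nat.mod_eq_of_lt (by omega)]
    omega
  · rintro ⟨a, b⟩ hx hx'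
    simp only [mem_sigma, mem_univ, mem_Ioi, true_and, Fin.lt_def] at hx
    have hne : ((b : ℕ) : ℚ) - ((a : ℕ) : ℚ) ≠ 0 :=
      sub_ne_zero.2 (by exact_mod_cast hx.ne')
    have : i ≤ (a : ℕ) ∨ ¬ i ≤ (b : ℕ) := by
      by_contra! h
      refine hx' ⟨⟨a + 1, b + 1⟩, ?_, ?_⟩
      · simp only [coe_sigma, Set.mem_sigma_iff, coe_Icc, Set.mem_Icc]
        omega
      · simp
    rw [div_eq_one_iff_eq hne]
    rcases this with h | h
    · simp [rectRow, h, h.trans hx.le]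
    · simp [rectRow, h, show ¬ i ≤ (a : ℕ) by omega]
  · rintro ⟨a, b⟩ hx
    simp only [mem_sigma, mem_Icc] at hx
    obtain ⟨⟨ha, hai⟩, hib, hb⟩ := hx
    obtain ⟨a, rfl⟩ := Nat.exists_eq_add_of_le' ha
    obtain ⟨b, rfl⟩ := Nat.exists_eq_add_of_le' ((Nat.le_add_left 1 i).trans hib)
    simp only [rectRow, Fin.ofNat, Nat.add_sub_cancel]
    rw [Nat.mod_eq_of_lt (by omega), Nat.mod_eq_of_lt (by omega), if_pos (by omega),
      if_neg (by omega)]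
    push_cast
    congr 1 <;> ring


theorem pattern_congr (G : (r : ℕ) → Fin r → ℤ) {r r' : ℕ} (hr : r = r') {j : Fin r} {j' : Fin r'}
    (hj : (j : ℕ) = j') : G r j = G r' j' := by
  subst hr
  rw [Fin.ext hj]

theorem gtPatterns_rectRow_le {n i m : ℕ} {G : (r : ℕ) → Fin r → ℤ}
    (hG : G ∈ gtPatterns (n + 1) (rectRow i m (n + 1))) {r : ℕ} (hr : r ≤ n + 1) (j : Fin r) :
    G r j ≤ j + if i ≤ j + (n + 1 - r) then (m : ℤ) else 0 := by
  obtain ⟨h1, -, h3⟩ := mem_gtPatterns.1 hG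
  induction hr using Nat.decreasingInduction with
  | self => simp [h1, rectRow]
  | of_succ r hr ih =>
    have h := ih j.succ
    have h' := (h3 r hr j).2
    simp only [Fin.val_succ, show (j : ℕ) + 1 + (n + 1 - (r + 1)) = j + (n + 1 - r) by omega] at h
    push_cast at h
    linarith

theorem le_gtPatterns_rectRow {n i m : ℕ} {G : (r : ℕ) → Fin r → ℤ}
    (hG : G ∈ gtPatterns (n + 1) (rectRow i m (n + 1))) {r : ℕ} (hr : r ≤ n + 1) (j : Fin r) :
    (j + if i ≤ (j : ℕ) then (m : ℤ) else 0) ≤ G r j := by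
  obtain ⟨h1, -, h3⟩ := mem_gtPatterns.1 hG
  induction hr using Nat.decreasingInduction with
  | self => simp [h1, rectRow]
  | of_succ r hr ih => exact (ih j.castSucc).trans (h3 r hr j).1

/-- The monotone fillings of the box `1 ≤ p ≤ i`, `i ≤ q ≤ n` with entries in `{0, …, m}`. -/
def orderArrays (n i m : ℕ) : Set Arr :=
  {F | (∀ p q, ¬(1 ≤ p ∧ p ≤ i ∧ i ≤ q ∧ q ≤ n) → F p q = 0) ∧
    ∀ p q, 1 ≤ p → p ≤ i → i ≤ q → q ≤ n →
      F (p - 1) q ≤ F p q ∧ F p (q - 1) ≤ F p q ∧ 0 ≤ F p q ∧ F p q ≤ m}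

theorem orderArrays_nonneg {n i m : ℕ} {F : Arr} (hF : F ∈ orderArrays n i m) (p q : ℕ) :
    0 ≤ F p q := by
  by_cases h : 1 ≤ p ∧ p ≤ i ∧ i ≤ q ∧ q ≤ n
  · exact (hF.2 p q h.1 h.2.1 h.2.2.1 h.2.2.2).2.2.1
  · exact (hF.1 p q h).ge

/-- The pattern attached to a monotone filling: the triangle above the rectangular top row is
frozen outside of the box. -/
def toPattern (n i m : ℕ) (F : Arr) : (r : ℕ) → Fin r → ℤ := fun r j =>
  if r ≤ n + 1 then j + if i ≤ (j : ℕ) then (m : ℤ) else F (j + 1) (n + j + 1 - r) else 0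

/-- The monotone filling attached to a pattern with rectangular top row. -/
def ofPattern (n i : ℕ) (G : (r : ℕ) → Fin r → ℤ) : Arr := fun p q =>
  if h : 1 ≤ p ∧ p ≤ i ∧ i ≤ q ∧ q ≤ n then
    G (n + p - q) ⟨p - 1, by omega⟩ - ((p - 1 : ℕ) : ℤ) else 0

theorem toPattern_mem {n i m : ℕ} (hi : 1 ≤ i) {F : Arr} (hF : F ∈ orderArrays n i m) :
    toPattern n i m F ∈ gtPatterns (n + 1) (rectRow i m (n + 1)) := by
  have hnonneg := orderArrays_nonneg hF
  obtain ⟨h0, h⟩ := hF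
  have hle : ∀ p q, F p q ≤ m := fun p q => by
    by_cases hb : 1 ≤ p ∧ p ≤ i ∧ i ≤ q ∧ q ≤ n
    · exact (h p q hb.1 hb.2.1 hb.2.2.1 hb.2.2.2).2.2.2
    · simp [h0 p q hb]
  refine mem_gtPatterns.2 ⟨?_, ?_, ?_⟩
  · funext j
    simp only [toPattern, rectRow, le_refl, if_true]
    congr 1
    split_ifs with hj
    · rfl
    · exact h0 _ _ (by omega)
  · intro r hr
    funext j
    simp [toPattern, show ¬ r ≤ n + 1 by omega]
  · intro r hr j
    have hj := j.isLt
    simp only [toPattern, show r ≤ n + 1 by omega, show r + 1 ≤ n + 1 by omega, if_true,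
      Fin.val_castSucc, Fin.val_succ]
    constructor
    · split_ifs with hij
      · rfl
      · by_cases hq : i ≤ n + j + 1 - r
        · have := (h (j + 1) (n + j + 1 - r) (by omega) (by omega) hq (by omega)).2.1
          rw [show n + j + 1 - r - 1 = n + j + 1 - (r + 1) by omega] at this
          linarith
        · rw [h0 _ (n + j + 1 - (r + 1)) (by omega)]
          linarith [hnonneg (j + 1) (n + j + 1 - r)]
    · rw [Nat.cast_add_one, show n + (j + 1 : ℕ) + 1 - (r + 1) = n + j + 1 - r by omega]
      by_cases hij : i ≤ j
      · rw [if_pos hij, if_pos (by omega)]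
        linarith
      · rw [if_neg hij]
        split_ifs with hij'
        · linarith [hle (j + 1) (n + j + 1 - r)]
        · by_cases hq : i ≤ n + j + 1 - r
          · have := (h (j + 1 + 1) (n + j + 1 - r) (by omega) (by omega) hq (by omega)).1
            rw [Nat.add_sub_cancel] at this
            linarith
          · rw [h0 _ (n + j + 1 - r) (by omega)]
            linarith [hnonneg (j + 1 + 1) (n + j + 1 - r)]

theorem ofPattern_mem {n i m : ℕ} {G : (r : ℕ) → Fin r → ℤ}
    (hG : G ∈ gtPatterns (n + 1) (rectRow i m (n + 1))) :
    ofPattern n i G ∈ orderArrays n i m := by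
  have hG' := (mem_gtPatterns.1 hG).2.2
  have hnonneg : ∀ p q, 0 ≤ ofPattern n i G p q := fun p q => by
    rw [ofPattern]
    split_ifs with h
    · have := le_gtPatterns_rectRow hG (show n + p - q ≤ n + 1 by omega) ⟨p - 1, by omega⟩
      rw [if_neg (by simp only; omega)] at this
      linarith
    · rfl
  refine ⟨fun p q h => dif_neg h, fun p q h1 h2 h3 h4 => ⟨?_, ?_, hnonneg p q, ?_⟩⟩
  · by_cases hp : 1 ≤ p - 1
    · rw [ofPattern, ofPattern, dif_pos ⟨hp, by omega, h3, h4⟩, dif_pos ⟨h1, h2, h3, h4⟩]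
      have := (hG' (n + (p - 1) - q) (by omega) ⟨p - 1 - 1, by omega⟩).2
      rw [pattern_congr G (show n + (p - 1) - q + 1 = n + p - q by omega)
        (j' := ⟨p - 1, by omega⟩) (by simp only [Fin.val_succ]; omega)] at this
      push_cast [hp, h1] at this ⊢
      linarith
    · rw [ofPattern, dif_neg (by omega)]
      exact hnonneg p q
  · by_cases hq : i ≤ q - 1
    · rw [ofPattern, ofPattern, dif_pos ⟨h1, h2, hq, by omega⟩, dif_pos ⟨h1, h2, h3, h4⟩]
      have := (hG' (n + p - q) (by omega) ⟨p - 1, by omega⟩).1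
      rw [pattern_congr G (show n + p - q + 1 = n + p - (q - 1) by omega)
        (j' := ⟨p - 1, by omega⟩) rfl] at this
      linarith
    · rw [ofPattern, dif_neg (by omega)]
      exact hnonneg p q
  · rw [ofPattern, dif_pos ⟨h1, h2, h3, h4⟩]
    have := gtPatterns_rectRow_le hG (show n + p - q ≤ n + 1 by omega) ⟨p - 1, by omega⟩
    split_ifs at this
    · linarith
    · linarith

theorem bijOn_toPattern {n i : ℕ} (hi : 1 ≤ i) (m : ℕ) :
    Set.BijOn (toPattern n i m) (orderArrays n i m)
      (gtPatterns (n + 1) (rectRow i m (n + 1))) := by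
  refine Set.InvOn.bijOn (f' := ofPattern n i) ⟨?_, ?_⟩ (fun F hF => toPattern_mem hi hF)
    (fun G hG => ofPattern_mem hG)
  · intro F hF
    funext p q
    rw [ofPattern]
    split_ifs with h
    · rw [toPattern, if_pos (by omega), if_neg (by simp only; omega)]
      simp only [Nat.sub_add_cancel h.1, add_sub_cancel_left]
      congr 1
      omega
    · exact (hF.1 p q h).symm
  · intro G hG
    funext r j
    have hj := j.isLt
    rw [toPattern]
    split_ifs with hr hij
    · have h1 := le_gtPatterns_rectRow hG hr j
      have h2 := gtPatterns_rectRow_le hG hr j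
      rw [if_pos hij] at h1
      rw [if_pos (by omega)] at h2
      linarith
    · by_cases hq : i ≤ n + j + 1 - r
      · rw [ofPattern, dif_pos (by omega)]
        rw [pattern_congr G (show n + (j + 1) - (n + j + 1 - r) = r by omega) (j' := j) (by simp)]
        simp
      · rw [ofPattern, dif_neg (by omega)]
        have h1 := le_gtPatterns_rectRow hG hr j
        have h2 := gtPatterns_rectRow_le hG hr j
        rw [if_neg hij] at h1
        rw [if_neg (by omega)] at h2
        linarith
    · rw [(mem_gtPatterns.1 hG).2.1 r (by omega)]
      rfl

/-- The largest sum of `A` along a lattice path ending at `(p, q)`. -/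
def maxPathSum (A : Arr) : ℕ → ℕ → ℤ
  | 0, _ => 0
  | _ + 1, 0 => 0
  | p + 1, q + 1 => A (p + 1) (q + 1) + max (maxPathSum A p (q + 1)) (maxPathSum A (p + 1) q)

theorem maxPathSum_eq (A : Arr) {p q : ℕ} (hp : 1 ≤ p) (hq : 1 ≤ q) :
    maxPathSum A p q = A p q + max (maxPathSum A (p - 1) q) (maxPathSum A p (q - 1)) := by
  obtain ⟨p, rfl⟩ := Nat.exists_eq_add_of_le' hp
  obtain ⟨q, rfl⟩ := Nat.exists_eq_add_of_le' hq
  rw [maxPathSum]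
  rfl

theorem maxPathSum_zero_left (A : Arr) (q : ℕ) : maxPathSum A 0 q = 0 := by
  rw [maxPathSum]

theorem maxPathSum_eq_zero {A : Arr} {i : ℕ} (h : ∀ p q, q < i → A p q = 0) (p : ℕ) {q : ℕ}
    (hq : q < i) : maxPathSum A p q = 0 := by
  induction p, q using maxPathSum.induct with
  | case1 => rw [maxPathSum]
  | case2 => rw [maxPathSum]
  | case3 p q ih1 ih2 => rw [maxPathSum, h _ _ hq, ih1 hq, ih2 (by omega)]; simp

/-- The step relation of Dyck paths. -/
def DyckStep (β γ : ℕ × ℕ) : Prop := γ = (β.1, β.2 + 1) ∨ γ = (β.1 + 1, β.2)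

/-- The path sums ending at `(p, q)` are bounded by any `F` that grows by at least `A` along
every step. -/
theorem path_sum_le {A F : Arr} {n i : ℕ}
    (hF0 : ∀ p q, 1 ≤ p → p ≤ i → i ≤ q → q ≤ n → A p q ≤ F p q)
    (hF1 : ∀ p q, 1 ≤ p → p ≤ i → i ≤ q → q ≤ n → A p q + F (p - 1) q ≤ F p q)
    (hF2 : ∀ p q, 1 ≤ p → p ≤ i → i ≤ q → q ≤ n → A p q + F p (q - 1) ≤ F p q)
    (L : List (ℕ × ℕ)) (p q : ℕ) (hhead : L.head? = some (1, i))
    (hlast : L.getLast? = some (p, q)) (hL : L.IsChain DyckStep) :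
    1 ≤ p ∧ i ≤ q ∧ (p ≤ i → q ≤ n → (L.map fun β => A β.1 β.2).sum ≤ F p q) := by
  induction L using List.reverseRecOn generalizing p q with
  | nil => simp at hhead
  | append_singleton L x ih =>
    obtain rfl : x = (p, q) := by simpa using hlast
    rcases List.eq_nil_or_concat L with rfl | ⟨L', ⟨a, b⟩, rfl⟩
    · obtain ⟨rfl, rfl⟩ : p = 1 ∧ q = i := by simpa using hhead
      exact ⟨le_rfl, le_rfl, fun h1 h2 => by simpa using hF0 1 q le_rfl h1 le_rfl h2⟩
    · rw [List.isChain_append] at hL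
      obtain ⟨hL, -, hstep⟩ := hL
      obtain ⟨ha, hb, hs⟩ := ih a b (by simpa using hhead) (by simp) hL
      rw [List.map_append, List.sum_append]
      simp only [List.map_cons, List.map_nil, List.sum_cons, List.sum_nil, add_zero]
      rcases hstep (a, b) (by simp) (p, q) (by simp) with h | h
      · obtain ⟨rfl, rfl⟩ : p = a ∧ q = b + 1 := by simpa using h
        refine ⟨ha, by omega, fun h1 h2 => ?_⟩
        have := hF2 p (b + 1) ha h1 (by omega) h2
        rw [Nat.add_sub_cancel] at this
        linarith [hs h1 (by omega)]
      · obtain ⟨rfl, rfl⟩ : p = a + 1 ∧ q = b := by simpa using h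
        refine ⟨by omega, hb, fun h1 h2 => ?_⟩
        have := hF1 (a + 1) q (by omega) h1 hb h2
        rw [Nat.add_sub_cancel] at this
        linarith [hs (by omega) h2]

theorem exists_path_sum_eq {A : Arr} {i : ℕ} (hi : 1 ≤ i) (h0 : ∀ p q, q < i → A p q = 0)
    (hnonneg : ∀ p q, 0 ≤ maxPathSum A p q) (p q : ℕ) (hp : 1 ≤ p) (hq : i ≤ q) :
    ∃ L : List (ℕ × ℕ), L.head? = some (1, i) ∧ L.getLast? = some (p, q) ∧
      L.IsChain DyckStep ∧ (L.map fun β => A β.1 β.2).sum = maxPathSum A p q := by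
  have extend : ∀ p q a b, DyckStep (a, b) (p, q) →
      maxPathSum A p q = A p q + maxPathSum A a b →
      (∃ L : List (ℕ × ℕ), L.head? = some (1, i) ∧ L.getLast? = some (a, b) ∧
        L.IsChain DyckStep ∧ (L.map fun β => A β.1 β.2).sum = maxPathSum A a b) →
      ∃ L : List (ℕ × ℕ), L.head? = some (1, i) ∧ L.getLast? = some (p, q) ∧
        L.IsChain DyckStep ∧ (L.map fun β => A β.1 β.2).sum = maxPathSum A p q := by
    rintro p q a b hstep hsum ⟨L, h1, h2, h3, h4⟩
    refine ⟨L ++ [(p, q)], by simp [h1], by simp, ?_, ?_⟩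
    · rw [List.isChain_append]
      refine ⟨h3, by simp, ?_⟩
      rw [h2]
      simpa using hstep
    · rw [List.map_append, List.sum_append, h4, hsum]
      simp [add_comm]
  induction hN : p + q using Nat.strong_induction_on generalizing p q with
  | _ N ih =>
    subst hN
    have hrec := maxPathSum_eq A hp (hi.trans hq)
    by_cases hcorner : p = 1 ∧ q = i
    · obtain ⟨rfl, rfl⟩ := hcorner
      refine ⟨[(1, q)], rfl, rfl, by simp, ?_⟩
      rw [hrec, Nat.sub_self, maxPathSum_zero_left,
        maxPathSum_eq_zero h0 1 (show q - 1 < q by omega)]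
      simp
    by_cases hdir : 2 ≤ p ∧ (q = i ∨ maxPathSum A p (q - 1) ≤ maxPathSum A (p - 1) q)
    · refine extend p q (p - 1) q (Or.inr ?_) ?_ (ih _ ?_ (p - 1) q ?_ hq rfl)
      · simp; omega
      · rw [hrec, max_eq_left]
        rcases hdir.2 with rfl | h
        · rw [maxPathSum_eq_zero h0 p (show q - 1 < q by omega)]
          exact hnonneg _ _
        · exact h
      all_goals omega
    · refine extend p q p (q - 1) (Or.inl ?_) ?_ (ih _ ?_ p (q - 1) hp ?_ rfl)
      · simp; omega
      · rw [hrec, max_eq_right]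
        by_cases hp1 : p = 1
        · subst hp1
          rw [Nat.sub_self, maxPathSum_zero_left]
          exact hnonneg _ _
        · exact (not_le.1 fun h => hdir ⟨by omega, Or.inr h⟩).le
      all_goals omega

theorem maxPathSum_nonneg {A : Arr} (hA : ∀ p q, 0 ≤ A p q) (p q : ℕ) : 0 ≤ maxPathSum A p q := by
  induction p, q using maxPathSum.induct with
  | case1 => rw [maxPathSum]
  | case2 => rw [maxPathSum]
  | case3 p q ih1 ih2 =>
    rw [maxPathSum]
    exact add_nonneg (hA _ _) (le_max_of_le_left ih1)

theorem maxPathSum_mono {A : Arr} (hA : ∀ p q, 0 ≤ A p q) {p p' q q' : ℕ} (hp : p ≤ p')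
    (hq : q ≤ q') : maxPathSum A p q ≤ maxPathSum A p' q' := by
  have h1 : ∀ p q, maxPathSum A p q ≤ maxPathSum A (p + 1) q := by
    rintro p (_ | q)
    · cases p <;> simp [maxPathSum]
    · rw [maxPathSum.eq_3]
      exact (le_max_left _ _).trans (le_add_of_nonneg_left (hA _ _))
  have h2 : ∀ p q, maxPathSum A p q ≤ maxPathSum A p (q + 1) := by
    rintro (_ | p) q
    · simp [maxPathSum]
    · rw [maxPathSum.eq_3 A p q]
      exact (le_max_right _ _).trans (le_add_of_nonneg_left (hA _ _))
  exact (monotone_nat_of_le_succ (f := fun p => maxPathSum A p q) (fun p => h1 p q) hp).trans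
    (monotone_nat_of_le_succ (h2 p') hq)

/-- The transfer map from the chain polytope to the order polytope of the box. -/
def toOrder (n i : ℕ) (A : Arr) : Arr := fun p q =>
  if 1 ≤ p ∧ p ≤ i ∧ i ≤ q ∧ q ≤ n then maxPathSum A p q else 0

/-- The inverse of the transfer map. -/
def ofOrder (n i : ℕ) (F : Arr) : Arr := fun p q =>
  if 1 ≤ p ∧ p ≤ i ∧ i ≤ q ∧ q ≤ n then F p q - max (F (p - 1) q) (F p (q - 1)) else 0

theorem toOrder_eq {n i : ℕ} {A : Arr} (h0 : ∀ p q, q < i → A p q = 0) {p q : ℕ} (hp : p ≤ i)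
    (hq : q ≤ n) : toOrder n i A p q = maxPathSum A p q := by
  rw [toOrder]
  split_ifs with h
  · rfl
  · rcases (by omega : p = 0 ∨ q < i) with rfl | h
    · rw [maxPathSum_zero_left]
    · rw [maxPathSum_eq_zero h0 p h]

theorem toOrder_mem {n i m : ℕ} (hi : 1 ≤ i) (hin : i ≤ n) {A : Arr} (hA : InB n i m A) :
    toOrder n i A ∈ orderArrays n i m := by
  obtain ⟨h1, h2, h3⟩ := hA
  have h0 : ∀ p q, q < i → A p q = 0 := fun p q h => h2 p q (by omega)
  have hnonneg : ∀ p q, 0 ≤ A p q := fun p q => by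
    by_cases h : 1 ≤ p ∧ p ≤ i ∧ i ≤ q ∧ q ≤ n
    · exact h1 p q h.1 h.2.1 h.2.2.1 h.2.2.2
    · exact (h2 p q h).ge
  refine ⟨fun p q h => if_neg h, fun p q hp1 hp2 hq1 hq2 => ?_⟩
  rw [toOrder_eq h0 hp2 hq2, toOrder_eq h0 ((Nat.sub_le _ _).trans hp2) hq2,
    toOrder_eq h0 hp2 ((Nat.sub_le _ _).trans hq2)]
  refine ⟨maxPathSum_mono hnonneg (Nat.sub_le _ _) le_rfl,
    maxPathSum_mono hnonneg le_rfl (Nat.sub_le _ _), maxPathSum_nonneg hnonneg _ _,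
    (maxPathSum_mono hnonneg hp2 hq2).trans ?_⟩
  obtain ⟨L, hL1, hL2, hL3, hL4⟩ :=
    exists_path_sum_eq hi h0 (maxPathSum_nonneg hnonneg) i n hi hin
  rw [← hL4]
  exact h3 L ⟨by rintro rfl; simp at hL1, hL1, hL2, hL3⟩

theorem ofOrder_mem {n i m : ℕ} (hi : 1 ≤ i) (hin : i ≤ n) {F : Arr} (hF : F ∈ orderArrays n i m) :
    InB n i m (ofOrder n i F) := by
  refine ⟨fun p q h1 h2 h3 h4 => ?_, fun p q h => if_neg h, ?_⟩
  · rw [ofOrder, if_pos ⟨h1, h2, h3, h4⟩, sub_nonneg]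
    obtain ⟨ha, hb, -⟩ := hF.2 p q h1 h2 h3 h4
    exact max_le ha hb
  · rintro L ⟨-, hL1, hL2, hL3⟩
    refine ((path_sum_le (F := F) (n := n) (i := i) ?_ ?_ ?_ L i n hL1 hL2 hL3).2.2
      le_rfl le_rfl).trans (hF.2 i n hi le_rfl hin le_rfl).2.2.2
    all_goals
      intro p q h1 h2 h3 h4
      rw [ofOrder, if_pos ⟨h1, h2, h3, h4⟩]
      have := le_max_left (F (p - 1) q) (F p (q - 1))
      have := le_max_right (F (p - 1) q) (F p (q - 1))
      have := orderArrays_nonneg hF (p - 1) q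
      linarith

theorem maxPathSum_ofOrder {n i m : ℕ} {F : Arr} (hF : F ∈ orderArrays n i m) {p q : ℕ}
    (hp : p ≤ i) (hq : q ≤ n) (hi : 1 ≤ i) : maxPathSum (ofOrder n i F) p q = F p q := by
  induction p, q using maxPathSum.induct with
  | case1 q => rw [maxPathSum, hF.1 _ _ (by omega)]
  | case2 p => rw [maxPathSum, hF.1 _ _ (by omega)]
  | case3 p q ih1 ih2 =>
    rw [maxPathSum, ih1 (by omega) hq, ih2 hp (by omega), ofOrder]
    split_ifs with h
    · simp
    · rw [hF.1 p (q + 1) (by omega), hF.1 (p + 1) q (by omega), hF.1 (p + 1) (q + 1) h]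
      simp

theorem bijOn_toOrder {n i : ℕ} (hi : 1 ≤ i) (hin : i ≤ n) (m : ℕ) :
    Set.BijOn (toOrder n i) {A | InB n i m A} (orderArrays n i m) := by
  refine Set.InvOn.bijOn (f' := ofOrder n i) ⟨?_, ?_⟩ (fun A hA => toOrder_mem hi hin hA)
    (fun F hF => ofOrder_mem hi hin hF)
  · intro A hA
    have h0 : ∀ p q, q < i → A p q = 0 := fun p q h => hA.2.1 p q (by omega)
    funext p q
    rw [ofOrder]
    split_ifs with h
    · rw [toOrder_eq h0 h.2.1 h.2.2.2, toOrder_eq h0 (by omega) h.2.2.2,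
        toOrder_eq h0 h.2.1 (by omega), maxPathSum_eq A h.1 (by omega), add_sub_cancel_right]
    · exact (hA.2.1 p q h).symm
  · intro F hF
    funext p q
    rw [toOrder]
    split_ifs with h
    · exact maxPathSum_ofOrder hF h.2.1 h.2.2.2 hi
    · exact (hF.1 p q h).symm

/-- `B^{m,i}` is finite and its cardinality equals
`dim V(mω_i) = ∏_{a=1}^{i} ∏_{b=i+1}^{n+1} (m + b − a)/(b − a)`. -/
theorem stmt0 (n i m : ℕ) (hi : 1 ≤ i) (hin : i ≤ n) :
    {A : Arr | InB n i m A}.Finite ∧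
    (({A : Arr | InB n i m A}.ncard : ℚ) =
      ∏ a ∈ Finset.Icc 1 i, ∏ b ∈ Finset.Icc (i + 1) (n + 1),
        ((m : ℚ) + (b : ℚ) - (a : ℚ)) / ((b : ℚ) - (a : ℚ))) := by
  have h := (bijOn_toPattern hi m).comp (bijOn_toOrder hi hin m)
  refine ⟨h.finite_iff_finite.2 (finite_toSet _), ?_⟩
  rw [h.ncard_eq, Set.ncard_coe_finset, card_gtPatterns_rectRow hin]

end KR
end

section
/- For every A ∈ B^{m,i} and every l ∈ {1,…,n}, one has φ_l(A) = ε_l(A) + ⟨α_l^∨, wt(A)⟩. -/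
open Finset

namespace KR

/-- The set of maximizers of a function on a nonempty interval is nonempty. -/
theorem maximizers_nonempty {a b : ℕ} (hab : a ≤ b) (F : ℕ → ℤ) :
    {p | p ∈ Icc a b ∧ ∀ q ∈ Icc a b, F q ≤ F p}.Nonempty := by
  obtain ⟨x, hx, h⟩ := exists_max_image (Icc a b) F ⟨a, by simp [hab]⟩
  exact ⟨x, hx, h⟩

theorem sInf_maximizers_mem {a b : ℕ} (hab : a ≤ b) (F : ℕ → ℤ) :
    sInf {p | p ∈ Icc a b ∧ ∀ q ∈ Icc a b, F q ≤ F p} ∈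
      {p | p ∈ Icc a b ∧ ∀ q ∈ Icc a b, F q ≤ F p} :=
  Nat.sInf_mem (maximizers_nonempty hab F)

theorem sSup_maximizers_mem {a b : ℕ} (hab : a ≤ b) (F : ℕ → ℤ) :
    sSup {p | p ∈ Icc a b ∧ ∀ q ∈ Icc a b, F q ≤ F p} ∈
      {p | p ∈ Icc a b ∧ ∀ q ∈ Icc a b, F q ≤ F p} :=
  Nat.sSup_mem (maximizers_nonempty hab F) ⟨b, fun _ hx => (mem_Icc.1 hx.1).2⟩

/-- An interval sum split before an interior point. -/
theorem sum_Icc_split_pred (f : ℕ → ℤ) {a p b : ℕ} (ha : 1 ≤ a) (hap : a ≤ p) (hpb : p ≤ b) :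
    ∑ j ∈ Icc a (p - 1), f j + ∑ j ∈ Icc p b, f j = ∑ j ∈ Icc a b, f j := by
  rw [← sum_union (disjoint_left.2 fun x hx hy => by simp only [mem_Icc] at hx hy; omega)]
  congr 1
  ext x
  simp only [mem_union, mem_Icc]
  omega

/-- An interval sum split after an interior point. -/
theorem sum_Icc_split_succ (f : ℕ → ℤ) {a p b : ℕ} (hap : a ≤ p) (hpb : p ≤ b) :
    ∑ j ∈ Icc a p, f j + ∑ j ∈ Icc (p + 1) b, f j = ∑ j ∈ Icc a b, f j := by
  rw [← sum_union (disjoint_left.2 fun x hx hy => by simp only [mem_Icc] at hx hy; omega)]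
  congr 1
  ext x
  simp only [mem_union, mem_Icc]
  omega

theorem pairing_of_eq (n i m : ℕ) (hi : 1 ≤ i) (hin : i ≤ n) (A : Arr) :
    pairing n i m i A = m - ∑ p ∈ Icc 1 i, A p i - ∑ q ∈ Icc i n, A i q := by
  have h : ∀ p ∈ Icc 1 i, ∑ q ∈ Icc i n, A p q * clpq i p q =
      A p i + if p = i then ∑ q ∈ Icc i n, A i q else 0 := by
    intro p hp
    rw [mem_Icc] at hp
    have hc : ∀ q ∈ Icc i n, A p q * clpq i p q =
        (if q = i then A p q else 0) + if p = i then A p q else 0 := by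
      intro q hq
      rw [mem_Icc] at hq
      unfold clpq
      split_ifs <;> omega
    rw [sum_congr rfl hc, sum_add_distrib, sum_ite_eq_of_mem' _ _ _ (by simp [hin])]
    split_ifs with hpi <;> simp [hpi]
  rw [pairing, sum_congr rfl h, sum_add_distrib, sum_ite_eq_of_mem' _ _ _ (by simp [hi])]
  simp
  ring

theorem pairing_of_gt (n i m l : ℕ) (hil : i < l) (hln : l ≤ n) (A : Arr) :
    pairing n i m l A = ∑ p ∈ Icc 1 i, A p (l - 1) - ∑ p ∈ Icc 1 i, A p l := by
  have h : ∀ p ∈ Icc 1 i, ∑ q ∈ Icc i n, A p q * clpq l p q = A p l - A p (l - 1) := by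
    intro p hp
    rw [mem_Icc] at hp
    have hc : ∀ q ∈ Icc i n, A p q * clpq l p q =
        (if q = l then A p q else 0) - if q = l - 1 then A p q else 0 := by
      intro q hq
      rw [mem_Icc] at hq
      unfold clpq
      split_ifs <;> omega
    rw [sum_congr rfl hc, sum_sub_distrib,
      sum_ite_eq_of_mem' _ _ _ (by rw [mem_Icc]; omega),
      sum_ite_eq_of_mem' _ _ _ (by rw [mem_Icc]; omega)]
  rw [pairing, sum_congr rfl h, sum_sub_distrib, if_neg hil.ne']
  ring

theorem pairing_of_lt (n i m l : ℕ) (hl : 1 ≤ l) (hli : l < i) (A : Arr) :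
    pairing n i m l A = ∑ q ∈ Icc i n, A (l + 1) q - ∑ q ∈ Icc i n, A l q := by
  have h : ∀ q ∈ Icc i n, ∑ p ∈ Icc 1 i, A p q * clpq l p q = A l q - A (l + 1) q := by
    intro q hq
    rw [mem_Icc] at hq
    have hc : ∀ p ∈ Icc 1 i, A p q * clpq l p q =
        (if p = l then A p q else 0) - if p = l + 1 then A p q else 0 := by
      intro p hp
      rw [mem_Icc] at hp
      unfold clpq
      split_ifs <;> omega
    rw [sum_congr rfl hc, sum_sub_distrib,
      sum_ite_eq_of_mem' _ _ _ (by rw [mem_Icc]; omega),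
      sum_ite_eq_of_mem' _ _ _ (by rw [mem_Icc]; omega)]
  rw [pairing, sum_comm, sum_congr rfl h, sum_sub_distrib, if_neg hli.ne]
  ring

/-- For every `A ∈ B^{m,i}` and `l ∈ {1,…,n}`,
`φ_l(A) = ε_l(A) + ⟨α_l^∨, wt(A)⟩`. -/
theorem stmt1 (n i m : ℕ) (hi : 1 ≤ i) (hin : i ≤ n) (A : Arr) (hA : InB n i m A)
    (l : ℕ) (hl : l ∈ Finset.Icc 1 n) :
    phi n i m l A = eps n i m l A + pairing n i m l A := by
  rw [mem_Icc] at hl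
  obtain hli | rfl | hil := lt_trichotomy l i
  · obtain ⟨hp, hpmax⟩ := sSup_maximizers_mem hin (Fm n i A l)
    obtain ⟨hq, hqmax⟩ := sInf_maximizers_mem hin (Fm n i A l)
    rw [← pminus] at hp hpmax
    rw [← qminus] at hq hqmax
    have hF := le_antisymm (hqmax _ hp) (hpmax _ hq)
    rw [mem_Icc] at hp hq
    rw [pairing_of_lt n i m l hl.1 hli, phi, eps, if_neg hli.ne, if_neg hli.ne,
      if_neg hli.not_gt, if_neg hli.not_gt]
    have h₁ := sum_Icc_split_succ (A l) hp.1 hp.2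
    have h₂ := sum_Icc_split_pred (A (l + 1)) hi hq.1 hq.2
    simp only [Fm] at hF
    linarith
  · rw [pairing_of_eq n l m hi hin, phi, eps, if_pos rfl, if_pos rfl]
    have h := sum_Icc_split_pred (fun j => A j l) le_rfl hi le_rfl
    simp only [Icc_self, sum_singleton] at h
    linarith
  · obtain ⟨hp, hpmax⟩ := sInf_maximizers_mem hi (Fp i A l)
    obtain ⟨hq, hqmax⟩ := sSup_maximizers_mem hi (Fp i A l)
    rw [← pplus] at hp hpmax
    rw [← qplus] at hq hqmax
    have hF := le_antisymm (hqmax _ hp) (hpmax _ hq)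
    rw [mem_Icc] at hp hq
    rw [pairing_of_gt n i m l hil hl.2, phi, eps, if_neg hil.ne', if_neg hil.ne',
      if_pos hil, if_pos hil]
    have h₁ := sum_Icc_split_pred (fun j => A j l) le_rfl hp.1 hp.2
    have h₂ := sum_Icc_split_succ (fun j => A j (l - 1)) hq.1 hq.2
    simp only [Fp] at hF
    linarith

end KR
end

section
/- The Kashiwara operators preserve B^{m,i}: for every A ∈ B^{m,i} and every l ∈ {1,…,n}, if φ_l(A) > 0 then the array f_l A obtained by the replacement rule satisfies all Dyck path inequalities and hence lies in B^{m,i}, and if ε_l(A) > 0 then e_l A lies in B^{m,i}. -/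
open Finset

namespace KR

/-- The maximal weight of a monotone lattice path from `(0, 0)` to `(x, y)`. -/
def maxPath (w : ℕ → ℕ → ℤ) : ℕ → ℕ → ℤ
  | 0, 0 => w 0 0
  | x + 1, 0 => w (x + 1) 0 + maxPath w x 0
  | 0, y + 1 => w 0 (y + 1) + maxPath w 0 y
  | x + 1, y + 1 => w (x + 1) (y + 1) + max (maxPath w x (y + 1)) (maxPath w (x + 1) y)

theorem maxPath_transpose (w : ℕ → ℕ → ℤ) (x y : ℕ) :
    maxPath (fun a b => w b a) y x = maxPath w x y := by
  induction x generalizing y with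
  | zero =>
    induction y with
    | zero => simp [maxPath]
    | succ y ih => simp [maxPath, ih]
  | succ x ihx =>
    induction y with
    | zero => simp [maxPath, ihx]
    | succ y ih => simp [maxPath, ih, ihx, max_comm]

theorem add_maxPath_le_right (w : ℕ → ℕ → ℤ) (x y : ℕ) :
    w (x + 1) y + maxPath w x y ≤ maxPath w (x + 1) y := by
  cases y <;> simp [maxPath]

theorem add_maxPath_le_up (w : ℕ → ℕ → ℤ) (x y : ℕ) :
    w x (y + 1) + maxPath w x y ≤ maxPath w x (y + 1) := by
  cases x <;> simp [maxPath]

/-- A function satisfying the recursive inequalities of `maxPath` dominates it. -/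
theorem maxPath_le_of_forall {w V : ℕ → ℕ → ℤ} (h0 : w 0 0 ≤ V 0 0)
    (hx : ∀ x y, w (x + 1) y + V x y ≤ V (x + 1) y)
    (hy : ∀ x y, w x (y + 1) + V x y ≤ V x (y + 1)) (x y : ℕ) :
    maxPath w x y ≤ V x y := by
  induction x generalizing y with
  | zero =>
    induction y with
    | zero => simpa [maxPath]
    | succ y ih => have := hy 0 y; simp only [maxPath]; omega
  | succ x ihx =>
    induction y with
    | zero => have := hx x 0; have := ihx 0; simp only [maxPath]; omega
    | succ y ih =>
      have := hx x (y + 1)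
      have := hy (x + 1) y
      have := ihx (y + 1)
      simp only [maxPath]
      omega

theorem maxPath_mono {w w' : ℕ → ℕ → ℤ} (h : ∀ x y, w' x y ≤ w x y) (x y : ℕ) :
    maxPath w' x y ≤ maxPath w x y := by
  refine maxPath_le_of_forall ?_ (fun x y => ?_) (fun x y => ?_) x y
  · simpa [maxPath] using h 0 0
  · linarith [add_maxPath_le_right w x y, h (x + 1) y]
  · linarith [add_maxPath_le_up w x y, h x (y + 1)]

theorem maxPath_add_sum_le (w : ℕ → ℕ → ℤ) (t : ℕ) {r k : ℕ} (hrk : r ≤ k) :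
    maxPath w r t + ∑ j ∈ range k, w (j + 1) t ≤
      maxPath w k t + ∑ j ∈ range r, w (j + 1) t := by
  induction k, hrk using Nat.le_induction with
  | base => rfl
  | succ k _ ih =>
    rw [sum_range_succ]
    linarith [add_maxPath_le_right w k t]

/-- If `F` strictly prefers `k` to every smaller position, then every path reaching row `t + 1`
before column `k` can be improved by switching rows in column `k`. -/
theorem maxPath_lt_of_argmax {w : ℕ → ℕ → ℤ} {F : ℕ → ℤ} {k t : ℕ}
    (hF : ∀ x < k, F (x + 1) - F x = w (x + 1) t - w x (t + 1))
    (hk : ∀ x < k, F x < F k) {s : ℕ} (hs : s < k) :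
    maxPath w s (t + 1) + ∑ j ∈ range k, w j (t + 1) <
      maxPath w k t + ∑ j ∈ range (s + 1), w j (t + 1) := by
  have tele : ∀ r ≤ k, F r = F 0 + ∑ j ∈ range r, w (j + 1) t - ∑ j ∈ range r, w j (t + 1) := by
    intro r
    induction r with
    | zero => simp
    | succ r ih =>
      intro hr
      rw [sum_range_succ, sum_range_succ]
      linarith [ih (by omega), hF r (by omega)]
  have key : ∀ r < k, maxPath w r t + ∑ j ∈ range k, w j (t + 1) <
      maxPath w k t + ∑ j ∈ range r, w j (t + 1) := by
    intro r hr
    linarith [tele r hr.le, tele k le_rfl, hk r hr, maxPath_add_sum_le w t hr.le]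
  induction s with
  | zero =>
    have := key 0 hs
    simp only [maxPath, sum_range_succ, sum_range_zero] at this ⊢
    linarith
  | succ s ih =>
    have h1 := ih (by omega)
    have h2 := key (s + 1) hs
    rw [sum_range_succ]
    simp only [maxPath]
    omega

/-- Moving one unit of weight from `(k, t)` to `(k, t + 1)` does not increase the maximal path
weight when `k` is the first maximizer of `F`. -/
theorem maxPath_le_of_shift {w w' : ℕ → ℕ → ℤ} {F : ℕ → ℤ} {k t a b : ℕ}
    (hF : ∀ x < k, F (x + 1) - F x = w (x + 1) t - w x (t + 1))
    (hk : ∀ x < k, F x < F k)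
    (hw : ∀ x y, w' x y = w x y +
      if x = k ∧ y = t + 1 then 1 else if x = k ∧ y = t then -1 else 0) (hb : t < b) :
    maxPath w' a b ≤ maxPath w a b := by
  have h : maxPath w' a b ≤ maxPath w a b - if a = k ∧ b = t then 1 else 0 := by
    refine maxPath_le_of_forall (V := fun x y => maxPath w x y - if x = k ∧ y = t then 1 else 0)
      ?_ (fun x y => ?_) (fun x y => ?_) a b
    · simp only [hw, maxPath]
      rw [if_neg (show ¬(0 = k ∧ 0 = t + 1) by omega)]
      split_ifs <;> omega
    · have h1 := add_maxPath_le_right w x y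
      have h2 := add_maxPath_le_up w k t
      simp only [hw]
      by_cases hx : x + 1 = k ∧ y = t + 1
      · obtain ⟨rfl, rfl⟩ := hx
        have h3 := maxPath_lt_of_argmax hF hk (Nat.lt_succ_self x)
        simp
        omega
      · split_ifs <;> omega
    · have h1 := add_maxPath_le_up w x y
      simp only [hw]
      split_ifs <;> omega
  split_ifs at h <;> omega

/-- Raising the weight of the corner `(a, 0)` by one only affects the path through that corner. -/
theorem maxPath_le_of_corner {w w' : ℕ → ℕ → ℤ} {a b : ℕ} {m : ℤ}
    (hw : ∀ x y, w' x y = w x y + if x = a ∧ y = 0 then 1 else 0)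
    (hm : maxPath w a b ≤ m)
    (hc : ∑ j ∈ range (a + 1), w j 0 + ∑ j ∈ range b, w a (j + 1) < m) :
    maxPath w' a b ≤ m := by
  have row : ∀ x, maxPath w x 0 = ∑ j ∈ range (x + 1), w j 0 := by
    intro x
    induction x with
    | zero => simp [maxPath]
    | succ x ih => rw [sum_range_succ, ← ih, maxPath]; ring
  have left : ∀ x < a, ∀ y, maxPath w' x y = maxPath w x y := by
    intro x
    induction x with
    | zero =>
      intro hx y
      have : a ≠ 0 := by omega
      induction y with
      | zero => simp [maxPath, hw, this.symm]
      | succ y ih => simp [maxPath, hw, ih]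
    | succ x ihx =>
      intro hx y
      have : x + 1 ≠ a := by omega
      induction y with
      | zero => simp [maxPath, hw, this, ihx (by omega)]
      | succ y ih => simp [maxPath, hw, ih, ihx (by omega)]
  have main : ∀ y, maxPath w' a y ≤ max (maxPath w a y)
      (∑ j ∈ range (a + 1), w j 0 + ∑ j ∈ range y, w a (j + 1) + 1) := by
    intro y
    induction y with
    | zero =>
      rw [← row]
      apply le_max_of_le_right
      cases a with
      | zero => simp [maxPath, hw]
      | succ a => simp [maxPath, hw, left a (by omega)]; omega
    | succ y ih =>
      rw [sum_range_succ _ y]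
      cases a with
      | zero => simp only [maxPath, hw, zero_add, sum_range_one] at *; simp; omega
      | succ a =>
        have := left a (by omega) (y + 1)
        simp only [maxPath, hw] at *
        simp
        omega
  have := main b
  omega

section Lists

variable {α : Type*} {R : α → α → Prop} {g : ℕ → ℕ → α}

theorem sum_le_maxPath (f : α → ℤ)
    (H : ∀ x y β, R β (g x y) → β = g (x + 1) y ∨ β = g x (y + 1)) (L : List α) :
    ∀ β, (β :: L).IsChain R → (β :: L).getLast? = some (g 0 0) →
      ∃ x y, β = g x y ∧ ((β :: L).map f).sum ≤ maxPath (fun x y => f (g x y)) x y := by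
  induction L with
  | nil =>
    intro β _ hl
    refine ⟨0, 0, by simpa using hl, ?_⟩
    simp only [List.getLast?_singleton, Option.some.injEq] at hl
    simp [maxPath, hl]
  | cons γ L ih =>
    intro β hc hl
    rw [List.isChain_cons_cons] at hc
    rw [List.getLast?_cons_cons] at hl
    obtain ⟨x, y, rfl, hs⟩ := ih γ hc.2 hl
    rw [List.map_cons, List.sum_cons]
    rcases H x y β hc.1 with rfl | rfl
    · exact ⟨x + 1, y, rfl, by
        linarith [add_maxPath_le_right (fun x y => f (g x y)) x y]⟩
    · exact ⟨x, y + 1, rfl, by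
        linarith [add_maxPath_le_up (fun x y => f (g x y)) x y]⟩

theorem exists_list_sum_eq_maxPath (f : α → ℤ) {a b : ℕ}
    (Hx : ∀ x y, x < a → y ≤ b → R (g (x + 1) y) (g x y))
    (Hy : ∀ x y, x ≤ a → y < b → R (g x (y + 1)) (g x y)) (x y : ℕ) (hx : x ≤ a) (hy : y ≤ b) :
    ∃ L : List α, (g x y :: L).IsChain R ∧ (g x y :: L).getLast? = some (g 0 0) ∧
      ((g x y :: L).map f).sum = maxPath (fun x y => f (g x y)) x y := by
  have step : ∀ {β γ : α} {s : ℤ}, R β γ → (∃ L : List α, (γ :: L).IsChain R ∧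
      (γ :: L).getLast? = some (g 0 0) ∧ ((γ :: L).map f).sum = s) →
      ∃ L : List α, (β :: L).IsChain R ∧
      (β :: L).getLast? = some (g 0 0) ∧ ((β :: L).map f).sum = f β + s := by
    rintro β γ s hR ⟨L, h1, h2, h3⟩
    refine ⟨γ :: L, List.isChain_cons_cons.2 ⟨hR, h1⟩, ?_, ?_⟩
    · rwa [List.getLast?_cons_cons]
    · rw [List.map_cons, List.sum_cons, h3]
  induction x generalizing y with
  | zero =>
    induction y with
    | zero => exact ⟨[], by simp [maxPath]⟩
    | succ y ih => simpa only [maxPath] using step (Hy 0 y hx (by omega)) (ih (by omega))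
  | succ x ihx =>
    induction y with
    | zero => simpa only [maxPath] using step (Hx x 0 (by omega) hy) (ihx 0 (by omega) hy)
    | succ y ih =>
      simp only [maxPath]
      rcases le_total (maxPath (fun x y => f (g x y)) x (y + 1))
        (maxPath (fun x y => f (g x y)) (x + 1) y) with h | h
      · rw [max_eq_right h]
        exact step (Hy (x + 1) y hx (by omega)) (ih (by omega))
      · rw [max_eq_left h]
        exact step (Hx x (y + 1) (by omega) hy) (ihx (y + 1) (by omega) hy)

end Lists

theorem isDyck_bound_iff_maxPath_backward {n i : ℕ} (hi : 1 ≤ i) (hin : i ≤ n) (A : Arr) (m : ℤ) :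
    (∀ L, IsDyck n i L → (L.map fun β => A β.1 β.2).sum ≤ m) ↔
      maxPath (fun x y => A (i - x) (n - y)) (i - 1) (n - i) ≤ m := by
  constructor
  · intro h
    obtain ⟨L, hc, hl, hs⟩ := exists_list_sum_eq_maxPath (a := i - 1) (b := n - i)
      (R := fun β γ : ℕ × ℕ => γ = (β.1, β.2 + 1) ∨ γ = (β.1 + 1, β.2))
      (g := fun x y => (i - x, n - y)) (fun β => A β.1 β.2)
      (by intro x y hx hy; right; ext <;> simp; omega)
      (by intro x y hx hy; left; ext <;> simp; omega) (i - 1) (n - i) le_rfl le_rfl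
    have h1 : i - (i - 1) = 1 := by omega
    have h2 : n - (n - i) = i := by omega
    simp only [h1, h2] at hc hl hs
    rw [← hs]
    exact h _ ⟨by simp, by simp, by simpa using hl, hc⟩
  · rintro h L ⟨h0, hh, hl, hc⟩
    cases L with
    | nil => exact absurd rfl h0
    | cons β L =>
      obtain ⟨x, y, hxy, hs⟩ := sum_le_maxPath
        (R := fun β γ : ℕ × ℕ => γ = (β.1, β.2 + 1) ∨ γ = (β.1 + 1, β.2))
        (g := fun x y => (i - x, n - y)) (fun β => A β.1 β.2)
        (by
          rintro x y ⟨p, q⟩ hR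
          simp only [Prod.mk.injEq] at hR ⊢
          omega) L β hc (by simpa using hl)
      simp only [List.head?_cons, Option.some.injEq] at hh
      rw [hh, Prod.mk.injEq] at hxy
      obtain rfl : x = i - 1 := by omega
      obtain rfl : y = n - i := by omega
      exact hs.trans h

theorem isDyck_bound_iff_maxPath_forward {n i : ℕ} (hi : 1 ≤ i) (hin : i ≤ n) (A : Arr) (m : ℤ) :
    (∀ L, IsDyck n i L → (L.map fun β => A β.1 β.2).sum ≤ m) ↔
      maxPath (fun x y => A (x + 1) (i + y)) (i - 1) (n - i) ≤ m := by
  constructor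
  · intro h
    obtain ⟨L, hc, hl, hs⟩ := exists_list_sum_eq_maxPath (a := i - 1) (b := n - i)
      (R := fun γ β : ℕ × ℕ => γ = (β.1, β.2 + 1) ∨ γ = (β.1 + 1, β.2))
      (g := fun x y => (x + 1, i + y)) (fun β => A β.1 β.2)
      (by intro x y hx hy; right; ext <;> simp)
      (by intro x y hx hy; left; ext <;> simp; omega) (i - 1) (n - i) le_rfl le_rfl
    have h1 : i - 1 + 1 = i := by omega
    have h2 : i + (n - i) = n := by omega
    simp only [h1, h2] at hc hl hs
    rw [← hs, ← List.sum_reverse, ← List.map_reverse]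
    exact h _ ⟨by simp, by rw [List.head?_reverse, hl]; simp,
      by rw [List.getLast?_reverse]; simp, List.isChain_reverse.2 hc⟩
  · rintro h L ⟨h0, hh, hl, hc⟩
    rw [← List.sum_reverse, ← List.map_reverse]
    rw [← List.getLast?_reverse] at hh
    rw [← List.head?_reverse] at hl
    replace hc := List.isChain_reverse.2 ((List.reverse_reverse L).symm ▸ hc)
    generalize L.reverse = M at *
    cases M with
    | nil => simp at hl
    | cons β M =>
      obtain ⟨x, y, hxy, hs⟩ := sum_le_maxPath
        (R := fun γ β : ℕ × ℕ => γ = (β.1, β.2 + 1) ∨ γ = (β.1 + 1, β.2))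
        (g := fun x y => (x + 1, i + y)) (fun β => A β.1 β.2)
        (by
          rintro x y ⟨p, q⟩ hR
          simp only [Prod.mk.injEq] at hR ⊢
          omega) M β (by simpa using hc) (by simpa using hh)
      simp only [List.head?_cons, Option.some.injEq] at hl
      rw [hl, Prod.mk.injEq] at hxy
      obtain rfl : x = i - 1 := by omega
      obtain rfl : y = n - i := by omega
      exact hs.trans h

/-- The defining property of the minimal maximizer of a function on an interval. -/
theorem sInf_argmax_spec {a b : ℕ} (hab : a ≤ b) (F : ℕ → ℤ) {k : ℕ}
    (hk : k = sInf {p | p ∈ Icc a b ∧ ∀ q ∈ Icc a b, F q ≤ F p}) :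
    a ≤ k ∧ k ≤ b ∧ ∀ q, a ≤ q → q < k → F q < F k := by
  have hne : {p | p ∈ Icc a b ∧ ∀ q ∈ Icc a b, F q ≤ F p}.Nonempty :=
    (exists_max_image (Icc a b) F ⟨a, by simp [hab]⟩)
  have hmem := Nat.sInf_mem hne
  rw [← hk] at hmem
  obtain ⟨h1, h2⟩ := hmem
  have h1' := mem_Icc.1 h1
  refine ⟨h1'.1, h1'.2, fun q haq hqk => ?_⟩
  have hq : q ∈ Icc a b := by rw [mem_Icc]; omega
  refine lt_of_le_of_ne (h2 q hq) fun he => ?_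
  rw [hk] at hqk
  exact Nat.notMem_of_lt_sInf hqk ⟨hq, fun r hr => he ▸ h2 r hr⟩

/-- The defining property of the maximal maximizer of a function on an interval. -/
theorem sSup_argmax_spec {a b : ℕ} (hab : a ≤ b) (F : ℕ → ℤ) {k : ℕ}
    (hk : k = sSup {p | p ∈ Icc a b ∧ ∀ q ∈ Icc a b, F q ≤ F p}) :
    a ≤ k ∧ k ≤ b ∧ ∀ q, k < q → q ≤ b → F q < F k := by
  have hne : {p | p ∈ Icc a b ∧ ∀ q ∈ Icc a b, F q ≤ F p}.Nonempty :=
    (exists_max_image (Icc a b) F ⟨a, by simp [hab]⟩)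
  have hbdd : BddAbove {p | p ∈ Icc a b ∧ ∀ q ∈ Icc a b, F q ≤ F p} :=
    ⟨b, fun p hp => (mem_Icc.1 hp.1).2⟩
  have hmem := Nat.sSup_mem hne hbdd
  rw [← hk] at hmem
  obtain ⟨h1, h2⟩ := hmem
  have h1' := mem_Icc.1 h1
  refine ⟨h1'.1, h1'.2, fun q hqk hqb => ?_⟩
  have hq : q ∈ Icc a b := by rw [mem_Icc]; omega
  refine lt_of_le_of_ne (h2 q hq) fun he => ?_
  have := le_csSup hbdd (⟨hq, fun r hr => he ▸ h2 r hr⟩ :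
    q ∈ {p | p ∈ Icc a b ∧ ∀ q ∈ Icc a b, F q ≤ F p})
  omega

theorem sum_Icc_add_sum_Icc_succ_sub (u v : ℕ → ℤ) {a b p : ℕ} (ha : a ≤ p + 1) (hb : p ≤ b) :
    (∑ j ∈ Icc a (p + 1), u j + ∑ j ∈ Icc (p + 1) b, v j) -
      (∑ j ∈ Icc a p, u j + ∑ j ∈ Icc p b, v j) = u (p + 1) - v p := by
  rw [sum_Icc_succ_top ha, ← add_sum_Ioc_eq_sum_Icc hb, ← Order.succ_eq_add_one p,
    Icc_succ_left_eq_Ioc]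
  ring

theorem Fp_succ_sub (A : Arr) (l : ℕ) {i p : ℕ} (hp : p ≤ i) :
    Fp i A l (p + 1) - Fp i A l p = A (p + 1) (l - 1) - A p l :=
  sum_Icc_add_sum_Icc_succ_sub (fun j => A j (l - 1)) (fun j => A j l) (by omega) hp

theorem Fm_succ_sub (A : Arr) (l : ℕ) {n i p : ℕ} (hi : i ≤ p + 1) (hp : p ≤ n) :
    Fm n i A l (p + 1) - Fm n i A l p = A l (p + 1) - A (l + 1) p :=
  sum_Icc_add_sum_Icc_succ_sub (fun j => A l j) (fun j => A (l + 1) j) hi hp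

theorem InB.of_transfer {n i m : ℕ} {A A' : Arr} (hA : InB n i m A) {P Q P' Q' : ℕ}
    (hbox : 1 ≤ P ∧ P ≤ i ∧ i ≤ Q ∧ Q ≤ n) (hbox' : 1 ≤ P' ∧ P' ≤ i ∧ i ≤ Q' ∧ Q' ≤ n)
    (hpos : 0 < A P Q)
    (hA' : ∀ p q, A' p q = A p q +
      if p = P' ∧ q = Q' then 1 else if p = P ∧ q = Q then -1 else 0)
    (hpath : ∀ L, IsDyck n i L → (L.map fun β => A' β.1 β.2).sum ≤ (m : ℤ)) :
    InB n i m A' := by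
  refine ⟨fun p q h1 h2 h3 h4 => ?_, fun p q h => ?_, hpath⟩
  · have := hA.1 p q h1 h2 h3 h4
    rw [hA']
    split_ifs with h5 h6
    · omega
    · obtain ⟨rfl, rfl⟩ := h6; omega
    · omega
  · have := hA.2.1 p q h
    rw [hA', this, if_neg, if_neg] <;> first | rfl | (rintro ⟨rfl, rfl⟩; omega)

section Transfer

variable {n i m : ℕ} {A A' : Arr} {l p : ℕ}

theorem InB.fop_of_gt (hi : 1 ≤ i) (hA : InB n i m A) (hil : i < l) (hln : l ≤ n)
    (hp : p = pplus i A l)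
    (hphi : 0 < ∑ j ∈ Icc 1 p, A j (l - 1) - ∑ j ∈ Icc 1 (p - 1), A j l)
    (hA' : ∀ a b, A' a b = A a b +
      if a = p ∧ b = l then 1 else if a = p ∧ b = l - 1 then -1 else 0) :
    InB n i m A' := by
  obtain ⟨h1, h2, h3⟩ := sInf_argmax_spec hi (Fp i A l) hp
  refine hA.of_transfer (P := p) (Q := l - 1) (P' := p) (Q' := l) (by omega) (by omega) ?_ hA' ?_
  · rcases h1.eq_or_lt with rfl | h1
    · simpa using hphi
    · obtain ⟨r, rfl⟩ : ∃ r, p = r + 1 := ⟨p - 1, by omega⟩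
      have := h3 r (by omega) (by omega)
      have := Fp_succ_sub A l (show r ≤ i by omega)
      have := hA.1 r l (by omega) (by omega) (by omega) hln
      omega
  · have hb := hA.2.2
    rw [isDyck_bound_iff_maxPath_forward hi (by omega)] at hb ⊢
    refine (maxPath_le_of_shift (F := fun x => Fp i A l (x + 1)) (k := p - 1) (t := l - 1 - i)
      (fun x hx => ?_) (fun x hx => ?_) (fun x y => ?_) (by omega)).trans hb
    · have := Fp_succ_sub A l (show x + 1 ≤ i by omega)
      rwa [show i + (l - 1 - i) = l - 1 by omega, show i + (l - 1 - i + 1) = l by omega]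
    · have := h3 (x + 1) (by omega) (by omega)
      rwa [show p - 1 + 1 = p by omega]
    · simp only [hA']
      split_ifs <;> omega

theorem InB.eop_of_gt (hi : 1 ≤ i) (hA : InB n i m A) (hil : i < l) (hln : l ≤ n)
    (hp : p = qplus i A l)
    (heps : 0 < ∑ j ∈ Icc p i, A j l - ∑ j ∈ Icc (p + 1) i, A j (l - 1))
    (hA' : ∀ a b, A' a b = A a b +
      if a = p ∧ b = l - 1 then 1 else if a = p ∧ b = l then -1 else 0) :
    InB n i m A' := by
  obtain ⟨h1, h2, h3⟩ := sSup_argmax_spec hi (Fp i A l) hp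
  refine hA.of_transfer (P := p) (Q := l) (P' := p) (Q' := l - 1) (by omega) (by omega) ?_ hA' ?_
  · rcases h2.eq_or_lt with rfl | h2
    · simpa using heps
    · have := h3 (p + 1) (by omega) (by omega)
      have := Fp_succ_sub A l (show p ≤ i by omega)
      have := hA.1 (p + 1) (l - 1) (by omega) (by omega) (by omega) (by omega)
      omega
  · have hb := hA.2.2
    rw [isDyck_bound_iff_maxPath_backward hi (by omega)] at hb ⊢
    refine (maxPath_le_of_shift (F := fun x => Fp i A l (i - x)) (k := i - p) (t := n - l)
      (fun x hx => ?_) (fun x hx => ?_) (fun x y => ?_) (by omega)).trans hb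
    · have := Fp_succ_sub A l (show i - (x + 1) ≤ i by omega)
      rw [show i - (x + 1) + 1 = i - x by omega] at this
      rw [show n - (n - l) = l by omega, show n - (n - l + 1) = l - 1 by omega]
      omega
    · have := h3 (i - x) (by omega) (by omega)
      rwa [show i - (i - p) = p by omega]
    · simp only [hA']
      split_ifs <;> omega

theorem InB.fop_of_lt (hin : i ≤ n) (hA : InB n i m A) (hl : 1 ≤ l) (hli : l < i)
    (hp : p = pminus n i A l)
    (hphi : 0 < ∑ j ∈ Icc p n, A (l + 1) j - ∑ j ∈ Icc (p + 1) n, A l j)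
    (hA' : ∀ a b, A' a b = A a b +
      if a = l ∧ b = p then 1 else if a = l + 1 ∧ b = p then -1 else 0) :
    InB n i m A' := by
  obtain ⟨h1, h2, h3⟩ := sSup_argmax_spec hin (Fm n i A l) hp
  refine hA.of_transfer (P := l + 1) (Q := p) (P' := l) (Q' := p) (by omega) (by omega) ?_ hA' ?_
  · rcases h2.eq_or_lt with rfl | h2
    · simpa using hphi
    · have := h3 (p + 1) (by omega) (by omega)
      have := Fm_succ_sub A l (show i ≤ p + 1 by omega) (show p ≤ n by omega)
      have := hA.1 l (p + 1) (by omega) (by omega) (by omega) (by omega)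
      omega
  · have hb := hA.2.2
    rw [isDyck_bound_iff_maxPath_backward (by omega) hin, ← maxPath_transpose] at hb ⊢
    refine (maxPath_le_of_shift (F := fun x => Fm n i A l (n - x)) (k := n - p) (t := i - (l + 1))
      (fun x hx => ?_) (fun x hx => ?_) (fun x y => ?_) (by omega)).trans hb
    · have := Fm_succ_sub A l (show i ≤ n - (x + 1) + 1 by omega) (show n - (x + 1) ≤ n by omega)
      rw [show n - (x + 1) + 1 = n - x by omega] at this
      rw [show i - (i - (l + 1)) = l + 1 by omega, show i - (i - (l + 1) + 1) = l by omega]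
      omega
    · have := h3 (n - x) (by omega) (by omega)
      rwa [show n - (n - p) = p by omega]
    · simp only [hA']
      split_ifs <;> omega

theorem InB.eop_of_lt (hin : i ≤ n) (hA : InB n i m A) (hl : 1 ≤ l) (hli : l < i)
    (hp : p = qminus n i A l)
    (heps : 0 < ∑ j ∈ Icc i p, A l j - ∑ j ∈ Icc i (p - 1), A (l + 1) j)
    (hA' : ∀ a b, A' a b = A a b +
      if a = l + 1 ∧ b = p then 1 else if a = l ∧ b = p then -1 else 0) :
    InB n i m A' := by
  obtain ⟨h1, h2, h3⟩ := sInf_argmax_spec hin (Fm n i A l) hp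
  refine hA.of_transfer (P := l) (Q := p) (P' := l + 1) (Q' := p) (by omega) (by omega) ?_ hA' ?_
  · rcases h1.eq_or_lt with rfl | h1
    · simpa [Icc_eq_empty (show ¬ i ≤ i - 1 by omega)] using heps
    · obtain ⟨r, rfl⟩ : ∃ r, p = r + 1 := ⟨p - 1, by omega⟩
      have := h3 r (by omega) (by omega)
      have := Fm_succ_sub A l (show i ≤ r + 1 by omega) (show r ≤ n by omega)
      have := hA.1 (l + 1) r (by omega) (by omega) (by omega) (by omega)
      omega
  · have hb := hA.2.2
    rw [isDyck_bound_iff_maxPath_forward (by omega) hin, ← maxPath_transpose] at hb ⊢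
    refine (maxPath_le_of_shift (F := fun x => Fm n i A l (i + x)) (k := p - i) (t := l - 1)
      (fun x hx => ?_) (fun x hx => ?_) (fun x y => ?_) (by omega)).trans hb
    · have := Fm_succ_sub A l (show i ≤ i + x + 1 by omega) (show i + x ≤ n by omega)
      rwa [show l - 1 + 1 = l by omega]
    · have := h3 (i + x) (by omega) (by omega)
      rwa [show i + (p - i) = p by omega]
    · simp only [hA']
      split_ifs <;> omega

theorem InB.fop_of_eq (hi : 1 ≤ i) (hin : i ≤ n) (hA : InB n i m A)
    (hphi : 0 < (m : ℤ) - ∑ j ∈ Icc 1 (i - 1), A j i - ∑ j ∈ Icc i n, A i j)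
    (hA' : ∀ a b, A' a b = A a b + if a = i ∧ b = i then 1 else 0) :
    InB n i m A' := by
  refine ⟨fun p q h1 h2 h3 h4 => ?_, fun p q h => ?_, ?_⟩
  · have := hA.1 p q h1 h2 h3 h4
    rw [hA']
    split_ifs <;> omega
  · rw [hA', hA.2.1 p q h, if_neg (by omega), add_zero]
  · have hb := hA.2.2
    rw [isDyck_bound_iff_maxPath_forward hi hin] at hb ⊢
    refine maxPath_le_of_corner (fun x y => ?_) hb ?_
    · simp only [hA']
      split_ifs <;> omega
    · have h1 : ∑ j ∈ Icc 1 (i - 1), A j i = ∑ j ∈ range (i - 1), A (j + 1) i := by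
        rw [range_eq_Ico, sum_Ico_add' (fun j => A j i), ← Ico_add_one_right_eq_Icc, zero_add]
      have h2 : ∑ j ∈ Icc i n, A i j = A i i + ∑ j ∈ range (n - i), A i (i + (j + 1)) := by
        rw [← Ico_add_one_right_eq_Icc, sum_Ico_eq_sum_range, Nat.sub_add_comm hin,
          sum_range_succ', add_zero, add_comm]
      rw [sum_range_succ]
      simp only [show i - 1 + 1 = i by omega, add_zero]
      linarith

theorem InB.eop_of_eq (hi : 1 ≤ i) (hin : i ≤ n) (hA : InB n i m A) (heps : 0 < A i i)
    (hA' : ∀ a b, A' a b = A a b + if a = i ∧ b = i then -1 else 0) :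
    InB n i m A' := by
  refine ⟨fun p q h1 h2 h3 h4 => ?_, fun p q h => ?_, ?_⟩
  · have := hA.1 p q h1 h2 h3 h4
    rw [hA']
    split_ifs with h
    · obtain ⟨rfl, rfl⟩ := h; omega
    · omega
  · rw [hA', hA.2.1 p q h, if_neg (by omega), add_zero]
  · have hb := hA.2.2
    rw [isDyck_bound_iff_maxPath_forward hi hin] at hb ⊢
    refine (maxPath_mono (fun x y => ?_) _ _).trans hb
    simp only [hA']
    split_ifs <;> omega

end Transfer

theorem upd_add (A : Arr) (p q : ℕ) (v : ℤ) (a b : ℕ) :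
    upd A p q (A p q + v) a b = A a b + if a = p ∧ b = q then v else 0 := by
  unfold upd
  split_ifs with h
  · rw [h.1, h.2]
  · rw [add_zero]

theorem upd_upd_add (A : Arr) (p q p' q' : ℕ) (v v' : ℤ) (a b : ℕ) :
    upd (upd A p q (A p q + v)) p' q' (A p' q' + v') a b =
      A a b + if a = p' ∧ b = q' then v' else if a = p ∧ b = q then v else 0 := by
  unfold upd
  split_ifs with h1 h2
  · rw [h1.1, h1.2]
  · rw [h2.1, h2.2]
  · rw [add_zero]

/-- The Kashiwara operators preserve `B^{m,i}`. -/
theorem stmt2 (n i m : ℕ) (hi : 1 ≤ i) (hin : i ≤ n) (A : Arr) (hA : InB n i m A)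
    (l : ℕ) (hl : l ∈ Finset.Icc 1 n) :
    (0 < phi n i m l A → ∃ A', fop n i m l A = some A' ∧ InB n i m A') ∧
    (0 < eps n i m l A → ∃ A', eop n i m l A = some A' ∧ InB n i m A') := by
  obtain ⟨hl1, hln⟩ := mem_Icc.1 hl
  constructor
  · intro h
    refine ⟨_, if_neg h.ne', ?_⟩
    unfold phi at h
    rcases lt_trichotomy l i with hli | rfl | hli
    · rw [if_neg hli.ne, if_neg hli.not_gt] at h ⊢
      refine hA.fop_of_lt hin hl1 hli rfl h fun a b => ?_
      rw [sub_eq_add_neg, upd_upd_add]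
      split_ifs <;> omega
    · rw [if_pos rfl] at h ⊢
      exact hA.fop_of_eq hi hin h (upd_add A l l 1)
    · rw [if_neg hli.ne', if_pos hli] at h ⊢
      refine hA.fop_of_gt hi hli hln rfl h fun a b => ?_
      rw [sub_eq_add_neg, upd_upd_add]
  · intro h
    refine ⟨_, if_neg h.ne', ?_⟩
    unfold eps at h
    rcases lt_trichotomy l i with hli | rfl | hli
    · rw [if_neg hli.ne, if_neg hli.not_gt] at h ⊢
      refine hA.eop_of_lt hin hl1 hli rfl h fun a b => ?_
      rw [sub_eq_add_neg, upd_upd_add]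
    · rw [if_pos rfl] at h ⊢
      exact hA.eop_of_eq hi hin h (upd_add A l l (-1))
    · rw [if_neg hli.ne', if_pos hli] at h ⊢
      refine hA.eop_of_gt hi hli hln rfl h fun a b => ?_
      rw [sub_eq_add_neg, upd_upd_add]
      split_ifs <;> omega

end KR
end

section
/- The crystal B^{m,i} is semiregular: for every A ∈ B^{m,i} and every l ∈ {1,…,n}, ε_l(A) = max{k ≥ 0 | e_l^k A ≠ 0} and φ_l(A) = max{k ≥ 0 | f_l^k A ≠ 0}. -/
open Finset

namespace KR

/-! ### Counting iterations of a partial operator -/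

theorem iterate_bind_none {α : Type*} (op : α → Option α) (k : ℕ) :
    (fun o => Option.bind o op)^[k] none = none :=
  Function.iterate_fixed rfl k

theorem iterate_bind_ne_none_iff {α : Type*} (op : α → Option α) (v : α → ℤ)
    (hnone : ∀ x, v x = 0 → op x = none)
    (hsome : ∀ x, v x ≠ 0 → ∃ y, op x = some y ∧ v y = v x - 1) (k : ℕ) (x : α) (hx : 0 ≤ v x) :
    (fun o => Option.bind o op)^[k] (some x) ≠ none ↔ (k : ℤ) ≤ v x := by
  induction k generalizing x with
  | zero => simpa using hx
  | succ k ih =>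
    rw [Function.iterate_succ_apply, Option.bind_some]
    by_cases h : v x = 0
    · rw [hnone x h, iterate_bind_none, h]
      simp only [ne_eq, not_true_eq_false, false_iff]
      push_cast
      omega
    · obtain ⟨y, hy, hv⟩ := hsome x h
      rw [hy, ih y (by omega)]
      push_cast
      omega

theorem eq_sSup_iterate_bind {α : Type*} (op : α → Option α) (v : α → ℤ)
    (hnone : ∀ x, v x = 0 → op x = none)
    (hsome : ∀ x, v x ≠ 0 → ∃ y, op x = some y ∧ v y = v x - 1) (x : α) (hx : 0 ≤ v x) :
    v x = ((sSup {k : ℕ | (fun o => Option.bind o op)^[k] (some x) ≠ none} : ℕ) : ℤ) := by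
  have hset : {k : ℕ | (fun o => Option.bind o op)^[k] (some x) ≠ none} =
      Set.Iic (v x).toNat := by
    ext k
    rw [Set.mem_ofPred_eq, iterate_bind_ne_none_iff op v hnone hsome k x hx, Set.mem_Iic]
    omega
  rw [hset, csSup_Iic, Int.toNat_of_nonneg hx]

/-! ### Maximizers of `Gc` -/

/-- The set of maximizers of `F` on `{lo,…,hi}`. -/
def maximizers (lo hi : ℕ) (F : ℕ → ℤ) : Set ℕ :=
  {p | p ∈ Icc lo hi ∧ ∀ q ∈ Icc lo hi, F q ≤ F p}

theorem maximizers_nonempty_s3 {lo hi : ℕ} (h : lo ≤ hi) (F : ℕ → ℤ) :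
    (maximizers lo hi F).Nonempty :=
  (Icc lo hi).exists_max_image F (nonempty_Icc.mpr h)

theorem maximizers_bddAbove (lo hi : ℕ) (F : ℕ → ℤ) : BddAbove (maximizers lo hi F) :=
  ⟨hi, fun _ hp => (mem_Icc.mp hp.1).2⟩

theorem sInf_mem_maximizers {lo hi : ℕ} (h : lo ≤ hi) (F : ℕ → ℤ) :
    sInf (maximizers lo hi F) ∈ maximizers lo hi F :=
  Nat.sInf_mem (maximizers_nonempty_s3 h F)

theorem sSup_mem_maximizers {lo hi : ℕ} (h : lo ≤ hi) (F : ℕ → ℤ) :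
    sSup (maximizers lo hi F) ∈ maximizers lo hi F :=
  Nat.sSup_mem (maximizers_nonempty_s3 h F) (maximizers_bddAbove lo hi F)

theorem lt_of_lt_sInf_maximizers {lo hi : ℕ} (h : lo ≤ hi) (F : ℕ → ℤ) {q : ℕ}
    (hq : q ∈ Icc lo hi) (hlt : q < sInf (maximizers lo hi F)) :
    F q < F (sInf (maximizers lo hi F)) := by
  have hp := sInf_mem_maximizers h F
  by_contra! hle
  exact Nat.notMem_of_lt_sInf hlt ⟨hq, fun r hr => (hp.2 r hr).trans hle⟩

theorem lt_of_sSup_maximizers_lt {lo hi : ℕ} (h : lo ≤ hi) (F : ℕ → ℤ) {q : ℕ}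
    (hq : q ∈ Icc lo hi) (hlt : sSup (maximizers lo hi F) < q) :
    F q < F (sSup (maximizers lo hi F)) := by
  have hp := sSup_mem_maximizers h F
  by_contra! hle
  exact absurd (le_csSup (maximizers_bddAbove lo hi F)
    (show q ∈ maximizers lo hi F from ⟨hq, fun r hr => (hp.2 r hr).trans hle⟩)) (by omega)

/-- Add `s` to the entry of `a` in row `p`. -/
def bump (a : Col) (p : ℕ) (s : ℤ) : Col := fun j => a j + if j = p then s else 0

theorem sum_bump (a : Col) (p : ℕ) (s : ℤ) (S : Finset ℕ) :
    ∑ j ∈ S, bump a p s j = ∑ j ∈ S, a j + if p ∈ S then s else 0 := by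
  simp only [bump, sum_add_distrib, sum_ite_eq']

theorem Gc_bump {lo hi p q : ℕ} (a b : Col) (s : ℤ) (hp : p ∈ Icc lo hi) :
    Gc hi lo (bump a p s) (bump b p (-s)) q =
      Gc hi lo a b q + (if p ≤ q then s else 0) - if q ≤ p then s else 0 := by
  rw [mem_Icc] at hp
  simp only [Gc, sum_bump, mem_Icc, hp.1, hp.2, true_and, and_true]
  split_ifs <;> ring

theorem Gc_eq_of_mem_maximizers {lo hi p p' : ℕ} {F F' : ℕ → ℤ} (hp : p ∈ Icc lo hi)
    (hp' : p' ∈ maximizers lo hi F') (heq : F' p = F p) (hle : ∀ q ∈ Icc lo hi, F' q ≤ F p) :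
    F' p' = F p :=
  le_antisymm (hle p' hp'.1) (heq ▸ hp'.2 p hp)

theorem Gc_sInf_bump {lo hi : ℕ} (h : lo ≤ hi) (a b : Col) {p : ℕ}
    (hp : p = sInf (maximizers lo hi (Gc hi lo a b))) :
    Gc hi lo (bump a p (-1)) (bump b p 1)
      (sInf (maximizers lo hi (Gc hi lo (bump a p (-1)) (bump b p 1)))) = Gc hi lo a b p := by
  have hmem := sInf_mem_maximizers h (Gc hi lo a b)
  have hlt := fun q => lt_of_lt_sInf_maximizers h (Gc hi lo a b) (q := q)
  rw [← hp] at hmem hlt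
  have hG := fun q => Gc_bump (q := q) a b (-1) hmem.1
  rw [neg_neg] at hG
  refine Gc_eq_of_mem_maximizers hmem.1 (sInf_mem_maximizers h _) (by simp [hG]) fun q hq => ?_
  have h1 := hmem.2 q hq
  have h2 := hlt q hq
  rw [hG]
  split_ifs <;> omega

theorem Gc_sSup_bump {lo hi : ℕ} (h : lo ≤ hi) (a b : Col) {p : ℕ}
    (hp : p = sSup (maximizers lo hi (Gc hi lo a b))) :
    Gc hi lo (bump a p 1) (bump b p (-1))
      (sSup (maximizers lo hi (Gc hi lo (bump a p 1) (bump b p (-1))))) = Gc hi lo a b p := by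
  have hmem := sSup_mem_maximizers h (Gc hi lo a b)
  have hlt := fun q => lt_of_sSup_maximizers_lt h (Gc hi lo a b) (q := q)
  rw [← hp] at hmem hlt
  have hG := fun q => Gc_bump (q := q) a b 1 hmem.1
  refine Gc_eq_of_mem_maximizers hmem.1 (sSup_mem_maximizers h _) (by simp [hG]) fun q hq => ?_
  have h1 := hmem.2 q hq
  have h2 := hlt q hq
  rw [hG]
  split_ifs <;> omega

/-- `Σ_{j=lo}^{p} a_j − Σ_{j=lo}^{p−1} b_j` for the minimal maximizer `p` of `Gc`. -/
noncomputable def headExcess (lo hi : ℕ) (a b : Col) : ℤ :=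
  ∑ j ∈ Icc lo (sInf (maximizers lo hi (Gc hi lo a b))), a j -
    ∑ j ∈ Icc lo (sInf (maximizers lo hi (Gc hi lo a b)) - 1), b j

/-- `Σ_{j=p}^{hi} b_j − Σ_{j=p+1}^{hi} a_j` for the maximal maximizer `p` of `Gc`. -/
noncomputable def tailExcess (lo hi : ℕ) (a b : Col) : ℤ :=
  ∑ j ∈ Icc (sSup (maximizers lo hi (Gc hi lo a b))) hi, b j -
    ∑ j ∈ Icc (sSup (maximizers lo hi (Gc hi lo a b)) + 1) hi, a j

theorem headExcess_eq {lo hi : ℕ} (hlo : 1 ≤ lo) (h : lo ≤ hi) (a b : Col) :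
    headExcess lo hi a b =
      Gc hi lo a b (sInf (maximizers lo hi (Gc hi lo a b))) - ∑ j ∈ Icc lo hi, b j := by
  have hmem := mem_Icc.mp (sInf_mem_maximizers h (Gc hi lo a b)).1
  rw [headExcess]
  generalize sInf (maximizers lo hi (Gc hi lo a b)) = p at hmem ⊢
  have h1 : Icc lo (p - 1) = Ico lo p := by ext; simp only [mem_Icc, mem_Ico]; omega
  have h2 : Icc p hi = Ico p (hi + 1) := by ext; simp only [mem_Icc, mem_Ico]; omega
  have h3 : Icc lo hi = Ico lo (hi + 1) := by ext; simp only [mem_Icc, mem_Ico]; omega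
  rw [Gc, h1, h2, h3, ← sum_Ico_consecutive b hmem.1 (by omega : p ≤ hi + 1)]
  ring

theorem tailExcess_eq {lo hi : ℕ} (h : lo ≤ hi) (a b : Col) :
    tailExcess lo hi a b =
      Gc hi lo a b (sSup (maximizers lo hi (Gc hi lo a b))) - ∑ j ∈ Icc lo hi, a j := by
  have hmem := mem_Icc.mp (sSup_mem_maximizers h (Gc hi lo a b)).1
  rw [tailExcess]
  generalize sSup (maximizers lo hi (Gc hi lo a b)) = p at hmem ⊢
  have h1 : Icc lo p = Ico lo (p + 1) := by ext; simp only [mem_Icc, mem_Ico]; omega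
  have h2 : Icc (p + 1) hi = Ico (p + 1) (hi + 1) := by
    ext; simp only [mem_Icc, mem_Ico]; omega
  have h3 : Icc lo hi = Ico lo (hi + 1) := by ext; simp only [mem_Icc, mem_Ico]; omega
  rw [Gc, h1, h2, h3,
    ← sum_Ico_consecutive a (by omega : lo ≤ p + 1) (by omega : p + 1 ≤ hi + 1)]
  ring

theorem headExcess_bump {lo hi : ℕ} (hlo : 1 ≤ lo) (h : lo ≤ hi) (a b : Col) {p : ℕ}
    (hp : p = sInf (maximizers lo hi (Gc hi lo a b))) :
    headExcess lo hi (bump a p (-1)) (bump b p 1) = headExcess lo hi a b - 1 := by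
  have hmem : p ∈ Icc lo hi := hp ▸ (sInf_mem_maximizers h (Gc hi lo a b)).1
  rw [headExcess_eq hlo h, headExcess_eq hlo h, Gc_sInf_bump h a b hp, ← hp, sum_bump,
    if_pos hmem]
  ring

theorem tailExcess_bump {lo hi : ℕ} (h : lo ≤ hi) (a b : Col) {p : ℕ}
    (hp : p = sSup (maximizers lo hi (Gc hi lo a b))) :
    tailExcess lo hi (bump a p 1) (bump b p (-1)) = tailExcess lo hi a b - 1 := by
  have hmem : p ∈ Icc lo hi := hp ▸ (sSup_mem_maximizers h (Gc hi lo a b)).1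
  rw [tailExcess_eq h, tailExcess_eq h, Gc_sSup_bump h a b hp, ← hp, sum_bump, if_pos hmem]
  ring

theorem headExcess_nonneg {lo hi : ℕ} (hlo : 1 ≤ lo) (h : lo ≤ hi) (a b : Col)
    (ha : 0 ≤ a lo) : 0 ≤ headExcess lo hi a b := by
  have hmax := (sInf_mem_maximizers h (Gc hi lo a b)).2 lo (left_mem_Icc.mpr h)
  have hG : Gc hi lo a b lo = a lo + ∑ j ∈ Icc lo hi, b j := by simp [Gc]
  rw [headExcess_eq hlo h]
  omega

theorem tailExcess_nonneg {lo hi : ℕ} (h : lo ≤ hi) (a b : Col)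
    (hb : 0 ≤ b hi) : 0 ≤ tailExcess lo hi a b := by
  have hmax := (sSup_mem_maximizers h (Gc hi lo a b)).2 hi (right_mem_Icc.mpr h)
  have hG : Gc hi lo a b hi = ∑ j ∈ Icc lo hi, a j + b hi := by simp [Gc]
  rw [tailExcess_eq h]
  omega

/-! ### String lengths in terms of pairs of adjacent rows or columns -/

theorem phi_of_lt {n i m l : ℕ} (h : i < l) (A : Arr) :
    phi n i m l A = headExcess 1 i (fun j => A j (l - 1)) (fun j => A j l) := by
  rw [phi, if_neg h.ne', if_pos h]; rfl

theorem phi_of_gt {n i m l : ℕ} (h : l < i) (A : Arr) :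
    phi n i m l A = tailExcess i n (A l) (A (l + 1)) := by
  rw [phi, if_neg h.ne, if_neg h.not_gt]; rfl

theorem eps_of_lt {n i m l : ℕ} (h : i < l) (A : Arr) :
    eps n i m l A = tailExcess 1 i (fun j => A j (l - 1)) (fun j => A j l) := by
  rw [eps, if_neg h.ne', if_pos h]; rfl

theorem eps_of_gt {n i m l : ℕ} (h : l < i) (A : Arr) :
    eps n i m l A = headExcess i n (A l) (A (l + 1)) := by
  rw [eps, if_neg h.ne, if_neg h.not_gt]; rfl

theorem upd_upd_row_fst {A : Arr} {p q q' : ℕ} (h : q ≠ q') (s t : ℤ) :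
    (fun j => upd (upd A p q (A p q + s)) p q' (A p q' + t) j q) =
      bump (fun j => A j q) p s := by
  funext j
  by_cases hj : j = p <;> simp [upd, bump, hj, h]

theorem upd_upd_row_snd {A : Arr} {p q q' : ℕ} (s t : ℤ) :
    (fun j => upd (upd A p q (A p q + s)) p q' (A p q' + t) j q') =
      bump (fun j => A j q') p t := by
  funext j
  by_cases hj : j = p <;> simp [upd, bump, hj]

theorem upd_upd_col_fst {A : Arr} {p p' q : ℕ} (h : p ≠ p') (s t : ℤ) :
    upd (upd A p q (A p q + s)) p' q (A p' q + t) p = bump (A p) q s := by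
  funext j
  by_cases hj : j = q <;> simp [upd, bump, hj, h]

theorem upd_upd_col_snd {A : Arr} {p p' q : ℕ} (s t : ℤ) :
    upd (upd A p q (A p q + s)) p' q (A p' q + t) p' = bump (A p') q t := by
  funext j
  by_cases hj : j = q <;> simp [upd, bump, hj]

theorem fop_spec {n i m l : ℕ} (hi : 1 ≤ i) (hin : i ≤ n) (A : Arr) (h : phi n i m l A ≠ 0) :
    ∃ B, fop n i m l A = some B ∧ phi n i m l B = phi n i m l A - 1 := by
  rw [fop, if_neg h]
  refine ⟨_, rfl, ?_⟩
  rcases lt_trichotomy l i with hl | rfl | hl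
  · rw [if_neg hl.ne, if_neg hl.not_gt, phi_of_gt hl, phi_of_gt hl, sub_eq_add_neg (A (l + 1) _),
      upd_upd_col_fst l.lt_succ_self.ne, upd_upd_col_snd]
    exact tailExcess_bump hin _ _ rfl
  · simp only [if_true, phi]
    have hrow : upd A l l (A l l + 1) l = bump (A l) l 1 := by
      funext j
      by_cases hj : j = l <;> simp [upd, bump, hj]
    have hcol : ∑ j ∈ Icc 1 (l - 1), upd A l l (A l l + 1) j l = ∑ j ∈ Icc 1 (l - 1), A j l := by
      refine sum_congr rfl fun j hj => ?_
      have hne : j ≠ l := by rw [mem_Icc] at hj; omega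
      simp [upd, hne]
    rw [hrow, hcol, sum_bump, if_pos (left_mem_Icc.mpr hin)]
    ring
  · rw [if_neg hl.ne', if_pos hl, phi_of_lt hl, phi_of_lt hl, sub_eq_add_neg (A _ (l - 1)),
      upd_upd_row_fst (by omega), upd_upd_row_snd]
    exact headExcess_bump le_rfl hi _ _ rfl

theorem eop_spec {n i m l : ℕ} (hi : 1 ≤ i) (hin : i ≤ n) (A : Arr) (h : eps n i m l A ≠ 0) :
    ∃ B, eop n i m l A = some B ∧ eps n i m l B = eps n i m l A - 1 := by
  rw [eop, if_neg h]
  refine ⟨_, rfl, ?_⟩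
  rcases lt_trichotomy l i with hl | rfl | hl
  · rw [if_neg hl.ne, if_neg hl.not_gt, eps_of_gt hl, eps_of_gt hl, sub_eq_add_neg (A l _),
      upd_upd_col_fst l.lt_succ_self.ne, upd_upd_col_snd]
    exact headExcess_bump hi hin _ _ rfl
  · simp [eps, upd]
  · rw [if_neg hl.ne', if_pos hl, eps_of_lt hl, eps_of_lt hl, sub_eq_add_neg (A _ l),
      upd_upd_row_fst (by omega), upd_upd_row_snd]
    exact tailExcess_bump hi _ _ rfl

/-! ### Nonnegativity on `B^{m,i}` -/

/-- The Dyck path that runs along row `i` to `(i,i)` and then along column `i` to `(i,n)`. -/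
def hookPath (n i : ℕ) : List (ℕ × ℕ) :=
  (List.range' 1 (i - 1)).map (fun j => (j, i)) ++ (List.range' i (n + 1 - i)).map (fun j => (i, j))

theorem isDyck_hookPath {n i : ℕ} (hi : 1 ≤ i) (hin : i ≤ n) : IsDyck n i (hookPath n i) := by
  obtain ⟨k, rfl⟩ := Nat.exists_eq_add_of_le' hi
  obtain ⟨d, rfl⟩ := Nat.exists_eq_add_of_le hin
  have hd : k + 1 + d + 1 - (k + 1) = d + 1 := by omega
  rw [hookPath, hd, Nat.add_sub_cancel]
  refine ⟨?_, ?_, ?_, ?_⟩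
  · simp
  · cases k <;> simp [List.range'_succ]
  · rw [List.range'_concat]
    simp
  · refine List.isChain_append.mpr ?_
    refine ⟨?_, ?_, ?_⟩
    · rw [List.isChain_map]
      exact (List.isChain_range' 1 k 1).imp fun _ _ h => Or.inr (by rw [h])
    · rw [List.isChain_map]
      exact (List.isChain_range' (k + 1) (d + 1) 1).imp fun _ _ h => Or.inl (by rw [h])
    · cases k with
      | zero => simp
      | succ k =>
        rw [List.range'_concat, List.range'_succ]
        simp [add_comm]

theorem sum_map_range' (f : ℕ → ℤ) (s k : ℕ) :
    ((List.range' s k).map f).sum = ∑ j ∈ Ico s (s + k), f j := by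
  induction k with
  | zero => simp
  | succ k ih =>
    rw [List.range'_concat, List.map_append, List.sum_append, ih, ← add_assoc,
      sum_Ico_succ_top (Nat.le_add_right s k)]
    simp

theorem phi_nonneg {n i m l : ℕ} (hi : 1 ≤ i) (hin : i ≤ n) {A : Arr} (hA : InB n i m A)
    (hl : l ∈ Icc 1 n) : 0 ≤ phi n i m l A := by
  rw [mem_Icc] at hl
  rcases lt_trichotomy l i with h | rfl | h
  · rw [phi_of_gt h]
    exact tailExcess_nonneg hin _ _ (hA.1 _ _ (by omega) (by omega) hin le_rfl)
  · have hpath := hA.2.2 _ (isDyck_hookPath hi hin)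
    rw [hookPath, List.map_append, List.sum_append, List.map_map, List.map_map, sum_map_range',
      sum_map_range'] at hpath
    have h1 : Icc 1 (l - 1) = Ico 1 (1 + (l - 1)) := by ext; simp only [mem_Icc, mem_Ico]; omega
    have h2 : Icc l n = Ico l (l + (n + 1 - l)) := by ext; simp only [mem_Icc, mem_Ico]; omega
    rw [phi, if_pos rfl, h1, h2]
    simp only [Function.comp_apply] at hpath
    linarith
  · rw [phi_of_lt h]
    exact headExcess_nonneg le_rfl hi _ _ (hA.1 _ _ le_rfl hi (by omega) (by omega))

theorem eps_nonneg {n i m l : ℕ} (hi : 1 ≤ i) (hin : i ≤ n) {A : Arr} (hA : InB n i m A)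
    (hl : l ∈ Icc 1 n) : 0 ≤ eps n i m l A := by
  rw [mem_Icc] at hl
  rcases lt_trichotomy l i with h | rfl | h
  · rw [eps_of_gt h]
    exact headExcess_nonneg hi hin _ _ (hA.1 _ _ hl.1 h.le le_rfl hin)
  · rw [eps, if_pos rfl]
    exact hA.1 _ _ hi le_rfl le_rfl hin
  · rw [eps_of_lt h]
    exact tailExcess_nonneg hi _ _ (hA.1 _ _ hi le_rfl h.le hl.2)

/-- `B^{m,i}` is semiregular:
`ε_l(A) = max{k | e_l^k A ≠ 0}` and `φ_l(A) = max{k | f_l^k A ≠ 0}`. -/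
theorem stmt3 (n i m : ℕ) (hi : 1 ≤ i) (hin : i ≤ n) (A : Arr) (hA : InB n i m A)
    (l : ℕ) (hl : l ∈ Finset.Icc 1 n) :
    eps n i m l A =
      ((sSup {k : ℕ | (fun o => Option.bind o (eop n i m l))^[k] (some A) ≠ none} : ℕ) : ℤ) ∧
    phi n i m l A =
      ((sSup {k : ℕ | (fun o => Option.bind o (fop n i m l))^[k] (some A) ≠ none} : ℕ) : ℤ) := by
  exact ⟨eq_sSup_iterate_bind (eop n i m l) (eps n i m l) (fun _ h => if_pos h)
      (eop_spec hi hin) A (eps_nonneg hi hin hA hl),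
    eq_sSup_iterate_bind (fop n i m l) (phi n i m l) (fun _ h => if_pos h)
      (fop_spec hi hin) A (phi_nonneg hi hin hA hl)⟩

end KR
end

section
/- Let l ∈ {1,…,n} with l > i and A ∈ B^{m,i}. If f_l A ≠ 0 then q_+^l(f_l A) = p_+^l(A), and if e_l A ≠ 0 then p_+^l(e_l A) = q_+^l(A). -/
open Finset

namespace KR

theorem Fp_maximizers_nonempty {i : ℕ} (hi : 1 ≤ i) (A : Arr) (l : ℕ) :
    {p | p ∈ Icc 1 i ∧ ∀ q ∈ Icc 1 i, Fp i A l q ≤ Fp i A l p}.Nonempty :=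
  (Icc 1 i).exists_max_image (Fp i A l) ⟨1, by simp [hi]⟩

theorem Fp_maximizers_bddAbove (i : ℕ) (A : Arr) (l : ℕ) :
    BddAbove {p | p ∈ Icc 1 i ∧ ∀ q ∈ Icc 1 i, Fp i A l q ≤ Fp i A l p} :=
  ⟨i, fun _ hp => (mem_Icc.1 hp.1).2⟩

theorem pplus_isLeast {i : ℕ} (hi : 1 ≤ i) (A : Arr) (l : ℕ) :
    IsLeast {p | p ∈ Icc 1 i ∧ ∀ q ∈ Icc 1 i, Fp i A l q ≤ Fp i A l p} (pplus i A l) :=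
  ⟨Nat.sInf_mem (Fp_maximizers_nonempty hi A l), fun _ hp => Nat.sInf_le hp⟩

theorem qplus_isGreatest {i : ℕ} (hi : 1 ≤ i) (A : Arr) (l : ℕ) :
    IsGreatest {p | p ∈ Icc 1 i ∧ ∀ q ∈ Icc 1 i, Fp i A l q ≤ Fp i A l p} (qplus i A l) :=
  ⟨Nat.sSup_mem (Fp_maximizers_nonempty hi A l) (Fp_maximizers_bddAbove i A l),
    fun _ hp => le_csSup (Fp_maximizers_bddAbove i A l) hp⟩

theorem Fp_lt_of_lt_pplus {i : ℕ} (hi : 1 ≤ i) (A : Arr) {l p : ℕ} (hp : p ∈ Icc 1 i)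
    (h : p < pplus i A l) : Fp i A l p < Fp i A l (pplus i A l) := by
  have hm := pplus_isLeast hi A l
  by_contra! hle
  exact h.not_ge (hm.2 ⟨hp, fun q hq => (hm.1.2 q hq).trans hle⟩)

theorem Fp_lt_of_qplus_lt {i : ℕ} (hi : 1 ≤ i) (A : Arr) {l p : ℕ} (hp : p ∈ Icc 1 i)
    (h : qplus i A l < p) : Fp i A l p < Fp i A l (qplus i A l) := by
  have hm := qplus_isGreatest hi A l
  by_contra! hle
  exact h.not_ge (hm.2 ⟨hp, fun q hq => (hm.1.2 q hq).trans hle⟩)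

/-- Moving `c` from row `l - 1` to row `l` within column `r` raises `Fp` by `c` left of `r`,
lowers it by `c` right of `r`, and preserves its value at `r`. -/
theorem Fp_upd {i l r : ℕ} (hr : r ∈ Icc 1 i) (hl : 0 < l) (A : Arr) (c : ℤ) (p : ℕ) :
    Fp i (upd (upd A r (l - 1) (A r (l - 1) - c)) r l (A r l + c)) l p =
      Fp i A l p - (if r ≤ p then c else 0) + (if p ≤ r then c else 0) := by
  obtain ⟨hr1, hri⟩ := mem_Icc.1 hr
  have hne : l - 1 ≠ l := by omega
  have h₁ : ∀ j, upd (upd A r (l - 1) (A r (l - 1) - c)) r l (A r l + c) j (l - 1) =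
      A j (l - 1) - if r = j then c else 0 := by
    intro j
    by_cases h : j = r
    · simp [upd, hne, h]
    · simp [upd, h, Ne.symm h]
  have h₂ : ∀ j, upd (upd A r (l - 1) (A r (l - 1) - c)) r l (A r l + c) j l =
      A j l + if r = j then c else 0 := by
    intro j
    by_cases h : j = r
    · simp [upd, h]
    · simp [upd, h, Ne.symm h]
  simp only [Fp, h₁, h₂, sum_sub_distrib, sum_add_distrib, sum_ite_eq, mem_Icc, hr1, hri,
    true_and, and_true]
  ring

theorem qplus_upd_pplus {i l : ℕ} (hi : 1 ≤ i) (hl : 0 < l) (A : Arr) :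
    qplus i (upd (upd A (pplus i A l) (l - 1) (A (pplus i A l) (l - 1) - 1))
      (pplus i A l) l (A (pplus i A l) l + 1)) l = pplus i A l := by
  have hm := pplus_isLeast hi A l
  have hF := Fp_upd hm.1.1 hl A 1
  refine IsGreatest.csSup_eq ⟨⟨hm.1.1, fun q hq => ?_⟩, fun q hq => ?_⟩
  · have hle := hm.1.2 q hq
    have hlt := Fp_lt_of_lt_pplus (l := l) hi A hq
    rw [hF, hF]
    grind
  · have hle := hm.1.2 q hq.1
    have hmax := hq.2 _ hm.1.1
    rw [hF, hF] at hmax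
    grind

theorem pplus_upd_qplus {i l : ℕ} (hi : 1 ≤ i) (hl : 0 < l) (A : Arr) :
    pplus i (upd (upd A (qplus i A l) (l - 1) (A (qplus i A l) (l - 1) + 1))
      (qplus i A l) l (A (qplus i A l) l - 1)) l = qplus i A l := by
  have hm := qplus_isGreatest hi A l
  have hF := Fp_upd hm.1.1 hl A (-1)
  rw [sub_neg_eq_add, ← sub_eq_add_neg] at hF
  refine IsLeast.csInf_eq ⟨⟨hm.1.1, fun q hq => ?_⟩, fun q hq => ?_⟩
  · have hle := hm.1.2 q hq
    have hlt := Fp_lt_of_qplus_lt (l := l) hi A hq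
    rw [hF, hF]
    grind
  · have hle := hm.1.2 q hq.1
    have hmax := hq.2 _ hm.1.1
    rw [hF, hF] at hmax
    grind

/-- For `l > i`: if `f_l A ≠ 0` then `q_+^l(f_l A) = p_+^l(A)`,
and if `e_l A ≠ 0` then `p_+^l(e_l A) = q_+^l(A)`. -/
theorem stmt7 (n i m : ℕ) (hi : 1 ≤ i) (hin : i ≤ n) (A : Arr) (hA : InB n i m A)
    (l : ℕ) (hl : l ∈ Finset.Icc 1 n) (hil : i < l) :
    (∀ A', fop n i m l A = some A' → qplus i A' l = pplus i A l) ∧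
    (∀ A', eop n i m l A = some A' → pplus i A' l = qplus i A l) := by
  have hl0 : 0 < l := by omega
  constructor
  · intro A' h
    simp only [fop, hil.ne', hil, if_true, if_false, Option.ite_none_left_eq_some,
      Option.some.injEq] at h
    exact h.2 ▸ qplus_upd_pplus hi hl0 A
  · intro A' h
    simp only [eop, hil.ne', hil, if_true, if_false, Option.ite_none_left_eq_some,
      Option.some.injEq] at h
    exact h.2 ▸ pplus_upd_qplus hi hl0 A

end KR
end
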